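/- arXiv:1203.5186 — 2 statements merged into one kernel-verified Lean document; each statement's English description precedes it below -/
import Mathlib

section
/- Let G be a connected planar graph. Then there exists a vertex v of degree k with neighbors v_1,...,v_k ordered so that d(v_1) ≤ ... ≤ d(v_k), such that at least one of the following holds: (A1) k ≤ 2; (A2) k = 3 and d(v_1) ≤ 11; (A3) k = 4, d(v_1) ≤ 7 and d(v_2) ≤ 9; (A4) k = 5, d(v_1) ≤ 6, d(v_2) ≤ 7 and d(v_3) ≤ 8. -/
open SimpleGraph Finset

universe u

variable {V : Type u}

/-- A proper edge coloring with `k` colors: distinct edges sharing a vertex get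
different colors. -/
def ProperEC (G : SimpleGraph V) {k : ℕ} (φ : Sym2 V → Fin k) : Prop :=
  ∀ e₁ ∈ G.edgeSet, ∀ e₂ ∈ G.edgeSet, e₁ ≠ e₂ → (∃ x, x ∈ e₁ ∧ x ∈ e₂) → φ e₁ ≠ φ e₂

/-- An acyclic edge coloring: proper, and no cycle of `G` uses only two colors. -/
def AcyclicEC (G : SimpleGraph V) {k : ℕ} (φ : Sym2 V → Fin k) : Prop :=
  ProperEC G φ ∧
    ∀ (v : V) (w : G.Walk v v), w.IsCycle → 2 < (w.edges.map φ).toFinset.card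

/-- `G` has an acyclic edge coloring with `k` colors, i.e. `χ'_a(G) ≤ k`. -/
def HasAEC (G : SimpleGraph V) (k : ℕ) : Prop :=
  ∃ φ : Sym2 V → Fin k, AcyclicEC G φ

/-- `G` is acyclically edge `k`-critical: `χ'_a(G) > k` but every proper subgraph
admits an acyclic edge `k`-coloring. -/
def AcyclicallyEdgeCritical (G : SimpleGraph V) (k : ℕ) : Prop :=
  ¬ HasAEC G k ∧ ∀ H : SimpleGraph V, H ≤ G → H ≠ G → HasAEC H k

/-- `C_φ(v)`: the set of colors appearing on edges incident with `v`. -/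
def Cset (G : SimpleGraph V) {k : ℕ} (φ : Sym2 V → Fin k) (v : V) : Set (Fin k) :=
  {c | ∃ u, G.Adj v u ∧ φ s(v, u) = c}

/-- `H` is a minor of `G`: disjoint connected branch sets realizing the edges of `H`. -/
def HasMinor {W : Type*} (G : SimpleGraph V) (H : SimpleGraph W) : Prop :=
  ∃ f : W → Set V,
    (∀ w, (f w).Nonempty ∧ (G.induce (f w)).Connected) ∧
    (∀ w₁ w₂, w₁ ≠ w₂ → Disjoint (f w₁) (f w₂)) ∧
    ∀ w₁ w₂, H.Adj w₁ w₂ → ∃ v₁ ∈ f w₁, ∃ v₂ ∈ f w₂, G.Adj v₁ v₂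

/-- Planarity via Wagner's theorem: no `K₅` minor and no `K₃,₃` minor. -/
def IsPlanar (G : SimpleGraph V) : Prop :=
  ¬ HasMinor G (completeGraph (Fin 5)) ∧
    ¬ HasMinor G (completeBipartiteGraph (Fin 3) (Fin 3))

/-- A nonempty set `X` is cut-connected if every partition of `X` into two nonempty parts is crossed
by an edge of `G`. -/
def CutConnected (G : SimpleGraph V) (X : Set V) : Prop :=
  X.Nonempty ∧ ∀ P : Set V, (X ∩ P).Nonempty → (X \ P).Nonempty →
    ∃ u ∈ X ∩ P, ∃ v ∈ X \ P, G.Adj u v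

lemma CutConnected.induce_connected {G : SimpleGraph V} {X : Set V} (h : CutConnected G X) :
    (G.induce X).Connected := by
  obtain ⟨⟨x₀, hx₀⟩, h⟩ := h
  rw [connected_iff]
  refine ⟨fun x y => ?_, ⟨⟨x₀, hx₀⟩⟩⟩
  by_contra hxy
  obtain ⟨u, ⟨hu, hu', hxu⟩, v, ⟨hv, hvP⟩, huv⟩ :=
    h {v | ∃ hv : v ∈ X, (G.induce X).Reachable x ⟨v, hv⟩}
      ⟨x, x.2, x.2, Reachable.refl _⟩ ⟨y, y.2, fun ⟨_, hr⟩ => hxy hr⟩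
  refine hvP ⟨hv, hxu.trans (Adj.reachable ?_)⟩
  simpa using huv

lemma cutConnected_singleton (G : SimpleGraph V) (x : V) : CutConnected G {x} := by
  refine ⟨⟨x, rfl⟩, ?_⟩
  rintro P ⟨u, rfl, hu⟩ ⟨v, rfl, hv⟩
  exact absurd hu hv

lemma CutConnected.mono {G G' : SimpleGraph V} (hle : G ≤ G') {X : Set V}
    (h : CutConnected G X) : CutConnected G' X := by
  refine ⟨h.1, fun P h₁ h₂ => ?_⟩
  obtain ⟨u, hu, v, hv, huv⟩ := h.2 P h₁ h₂
  exact ⟨u, hu, v, hv, hle huv⟩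

lemma cutConnected_insert {G : SimpleGraph V} {X : Set V} {x y : V} (h : CutConnected G X)
    (hy : y ∈ X) (hxy : G.Adj x y) : CutConnected G (insert x X) := by
  refine ⟨⟨x, Or.inl rfl⟩, ?_⟩
  rintro P ⟨u, hu, huP⟩ ⟨v, hv, hvP⟩
  by_cases hx : x ∈ P <;> by_cases hyP : y ∈ P
  · have hvX : v ∈ X := by
      rcases hv with rfl | hv
      · exact absurd hx hvP
      · exact hv
    obtain ⟨p, hp, q, hq, hpq⟩ := h.2 P ⟨y, hy, hyP⟩ ⟨v, hvX, hvP⟩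
    exact ⟨p, ⟨Or.inr hp.1, hp.2⟩, q, ⟨Or.inr hq.1, hq.2⟩, hpq⟩
  · exact ⟨x, ⟨Or.inl rfl, hx⟩, y, ⟨Or.inr hy, hyP⟩, hxy⟩
  · exact ⟨y, ⟨Or.inr hy, hyP⟩, x, ⟨Or.inl rfl, hx⟩, hxy.symm⟩
  · have huX : u ∈ X := by
      rcases hu with rfl | hu
      · exact absurd huP hx
      · exact hu
    obtain ⟨p, hp, q, hq, hpq⟩ := h.2 P ⟨u, huX, huP⟩ ⟨y, hy, hyP⟩
    exact ⟨p, ⟨Or.inr hp.1, hp.2⟩, q, ⟨Or.inr hq.1, hq.2⟩, hpq⟩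

/-- Every point of a set `W` lies in a cut-connected subset of `W` that no edge inside `W`
leaves. -/
lemma exists_cutConnected_component (G : SimpleGraph V) (W : Set V) {x : V} (hx : x ∈ W) :
    ∃ Z ⊆ W, x ∈ Z ∧ CutConnected G Z ∧ ∀ u ∈ Z, ∀ v ∈ W, G.Adj u v → v ∈ Z := by
  let r : V → V → Prop := fun u v => G.Adj u v ∧ v ∈ W
  refine ⟨{v | Relation.ReflTransGen r x v}, ?_, Relation.ReflTransGen.refl, ⟨⟨x, .refl⟩, ?_⟩,
    fun u hu v hv huv => Relation.ReflTransGen.tail hu ⟨huv, hv⟩⟩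
  · intro v hv
    rcases Relation.ReflTransGen.cases_tail hv with h | ⟨u, _, h⟩
    · exact h ▸ hx
    · exact h.2
  · intro P hP hQ
    by_contra! hno
    have key : ∀ v, Relation.ReflTransGen r x v → (x ∈ P ↔ v ∈ P) := by
      intro v hv
      induction hv with
      | refl => rfl
      | @tail b c hb hbc ih =>
        refine ih.trans ⟨fun h => ?_, fun h => ?_⟩
        · by_contra hc
          exact hno b ⟨hb, h⟩ c ⟨hb.tail hbc, hc⟩ hbc.1
        · by_contra hc
          exact hno c ⟨hb.tail hbc, h⟩ b ⟨hb, hc⟩ hbc.1.symm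
    obtain ⟨u, hu, huP⟩ := hP
    obtain ⟨v, hv, hvP⟩ := hQ
    exact hvP ((key v hv).1 ((key u hu).2 huP))

/-- `H` is a minor of `G` with all branch sets inside `S`. -/
def HasMinorOn {W : Type*} (G : SimpleGraph V) (S : Set V) (H : SimpleGraph W) : Prop :=
  ∃ f : W → Set V, (∀ w, f w ⊆ S) ∧ (∀ w, CutConnected G (f w)) ∧
    (∀ w₁ w₂, w₁ ≠ w₂ → Disjoint (f w₁) (f w₂)) ∧
    ∀ w₁ w₂, H.Adj w₁ w₂ → ∃ v₁ ∈ f w₁, ∃ v₂ ∈ f w₂, G.Adj v₁ v₂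

lemma HasMinorOn.hasMinor {W : Type*} {G : SimpleGraph V} {S : Set V} {H : SimpleGraph W}
    (h : HasMinorOn G S H) : HasMinor G H := by
  obtain ⟨f, -, hf, hd, ha⟩ := h
  exact ⟨f, fun w => ⟨(hf w).1, (hf w).induce_connected⟩, hd, ha⟩

lemma HasMinorOn.mono {W : Type*} {G G' : SimpleGraph V} {S S' : Set V} {H : SimpleGraph W}
    (hG : G ≤ G') (hS : S ⊆ S') (h : HasMinorOn G S H) : HasMinorOn G' S' H := by
  obtain ⟨f, hfS, hf, hd, ha⟩ := h
  refine ⟨f, fun w => (hfS w).trans hS, fun w => (hf w).mono hG, hd, fun w₁ w₂ h => ?_⟩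
  obtain ⟨u, hu, v, hv, huv⟩ := ha w₁ w₂ h
  exact ⟨u, hu, v, hv, hG huv⟩

/-- Contracting a connected set `insert b T` to the vertex `b` creates no new minors. -/
lemma HasMinorOn.of_contract {W : Type*} {G G' : SimpleGraph V} {S T : Set V} {b : V}
    {H : SimpleGraph W} (hT : T ⊆ S) (hconn : CutConnected G (insert b T))
    (hadj : ∀ u v, G'.Adj u v → G.Adj u v ∨ (u = b ∧ ∃ t ∈ T, G.Adj t v) ∨
      (v = b ∧ ∃ t ∈ T, G.Adj u t))
    (h : HasMinorOn G' (S \ T) H) : HasMinorOn G S H := by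
  classical
  obtain ⟨f, hfS, hf, hd, ha⟩ := h
  let g : W → Set V := fun w => if b ∈ f w then f w ∪ T else f w
  have hfg : ∀ w, f w ⊆ g w := by
    intro w v hv
    by_cases hb : b ∈ f w
    · simp [g, hb, hv]
    · simp [g, hb, hv]
  have hTg : ∀ w, b ∈ f w → T ⊆ g w := by
    intro w hb v hv
    simp [g, hb, hv]
  have hg : ∀ w v, v ∈ g w → v ∈ f w ∨ (v ∈ T ∧ b ∈ f w) := by
    intro w v hv
    by_cases hb : b ∈ f w
    · simp only [g, hb, if_true] at hv
      exact hv.imp id fun h => ⟨h, hb⟩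
    · simp only [g, hb, if_false] at hv
      exact Or.inl hv
  have hfT : ∀ w v, v ∈ f w → v ∉ T := fun w v hv => (hfS w hv).2
  refine ⟨g, fun w v hv => ?_, fun w => ⟨(hf w).1.mono (hfg w), fun P hP hQ => ?_⟩,
    fun w₁ w₂ hw => ?_, fun w₁ w₂ hw => ?_⟩
  · rcases hg w v hv with h | h
    · exact (hfS w h).1
    · exact hT h.1
  · by_cases hb : b ∈ f w
    · have hins : insert b T ⊆ g w := Set.insert_subset (hfg w hb) (hTg w hb)
      by_cases hsplit : (insert b T ∩ P).Nonempty ∧ (insert b T \ P).Nonempty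
      · obtain ⟨u, hu, v, hv, huv⟩ := hconn.2 P hsplit.1 hsplit.2
        exact ⟨u, ⟨hins hu.1, hu.2⟩, v, ⟨hins hv.1, hv.2⟩, huv⟩
      · have hsame : ∀ t ∈ T, (t ∈ P ↔ b ∈ P) := by
          intro t ht
          constructor
          · intro h
            by_contra hbP
            exact hsplit ⟨⟨t, Or.inr ht, h⟩, ⟨b, Or.inl rfl, hbP⟩⟩
          · intro h
            by_contra htP
            exact hsplit ⟨⟨b, Or.inl rfl, h⟩, ⟨t, Or.inr ht, htP⟩⟩
        have hP' : (f w ∩ P).Nonempty := by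
          obtain ⟨u, hu, huP⟩ := hP
          rcases hg w u hu with h | h
          · exact ⟨u, h, huP⟩
          · exact ⟨b, hb, (hsame u h.1).1 huP⟩
        have hQ' : (f w \ P).Nonempty := by
          obtain ⟨u, hu, huP⟩ := hQ
          rcases hg w u hu with h | h
          · exact ⟨u, h, huP⟩
          · exact ⟨b, hb, fun hbP => huP ((hsame u h.1).2 hbP)⟩
        obtain ⟨u, hu, v, hv, huv⟩ := (hf w).2 P hP' hQ'
        rcases hadj u v huv with h | ⟨rfl, t, ht, h⟩ | ⟨rfl, t, ht, h⟩
        · exact ⟨u, ⟨hfg w hu.1, hu.2⟩, v, ⟨hfg w hv.1, hv.2⟩, h⟩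
        · exact ⟨t, ⟨hTg w hb ht, (hsame t ht).2 hu.2⟩, v, ⟨hfg w hv.1, hv.2⟩, h⟩
        · exact ⟨u, ⟨hfg w hu.1, hu.2⟩, t,
            ⟨hTg w hb ht, fun htP => hv.2 ((hsame t ht).1 htP)⟩, h⟩
    · have hgw : g w = f w := by simp [g, hb]
      rw [hgw] at hP hQ ⊢
      obtain ⟨u, hu, v, hv, huv⟩ := (hf w).2 P hP hQ
      rcases hadj u v huv with h | ⟨rfl, -⟩ | ⟨rfl, -⟩
      · exact ⟨u, hu, v, hv, h⟩
      · exact absurd hu.1 hb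
      · exact absurd hv.1 hb
  · rw [Set.disjoint_left]
    intro v hv₁ hv₂
    have hdj := Set.disjoint_left.1 (hd w₁ w₂ hw)
    rcases hg w₁ v hv₁ with h₁ | h₁ <;> rcases hg w₂ v hv₂ with h₂ | h₂
    · exact hdj h₁ h₂
    · exact hfT w₁ v h₁ h₂.1
    · exact hfT w₂ v h₂ h₁.1
    · exact hdj h₁.2 h₂.2
  · obtain ⟨u, hu, v, hv, huv⟩ := ha w₁ w₂ hw
    rcases hadj u v huv with h | ⟨rfl, t, ht, h⟩ | ⟨rfl, t, ht, h⟩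
    · exact ⟨u, hfg _ hu, v, hfg _ hv, h⟩
    · exact ⟨t, hTg _ hu ht, v, hfg _ hv, h⟩
    · exact ⟨u, hfg _ hu, t, hTg _ hv ht, h⟩

open Classical in
/-- The number of pairs in `A ×ˢ B` that are adjacent in `G`. -/
noncomputable def crossCount (G : SimpleGraph V) (A B : Finset V) : ℕ :=
  ∑ a ∈ A, #{b ∈ B | G.Adj a b}

lemma crossCount_comm (G : SimpleGraph V) (A B : Finset V) :
    crossCount G A B = crossCount G B A := by
  classical
  simp only [crossCount, card_filter]
  rw [sum_comm]
  simp only [G.adj_comm]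

open Classical in
lemma crossCount_erase_left (G : SimpleGraph V) {A : Finset V} (B : Finset V) {a : V}
    (ha : a ∈ A) :
    crossCount G (A.erase a) B + #{b ∈ B | G.Adj a b} = crossCount G A B := by
  rw [crossCount, crossCount]
  exact sum_erase_add A (fun a => #{b ∈ B | G.Adj a b}) ha

open Classical in
lemma crossCount_erase_right (G : SimpleGraph V) (A : Finset V) {B : Finset V} {b : V}
    (hb : b ∈ B) :
    crossCount G A (B.erase b) + #{a ∈ A | G.Adj b a} = crossCount G A B := by
  rw [crossCount_comm G A, crossCount_comm G A]
  exact crossCount_erase_left G A hb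

lemma crossCount_congr {G G' : SimpleGraph V} {A B : Finset V}
    (h : ∀ a ∈ A, ∀ b ∈ B, (G.Adj a b ↔ G'.Adj a b)) :
    crossCount G A B = crossCount G' A B := by
  classical
  exact sum_congr rfl fun a ha => congrArg card (filter_congr fun b hb => h a ha b hb)

open Classical in
lemma crossCount_erase_erase (G : SimpleGraph V) {S : Finset V} {b : V} (hb : b ∈ S) :
    crossCount G (S.erase b) (S.erase b) + 2 * #{v ∈ S | G.Adj b v} = crossCount G S S := by
  have h₁ := crossCount_erase_left G S hb
  have h₂ := crossCount_erase_right G (S.erase b) hb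
  have h₃ : #{v ∈ S.erase b | G.Adj b v} = #{v ∈ S | G.Adj b v} := by
    congr 1
    ext v
    simp only [mem_filter, mem_erase]
    exact ⟨fun h => ⟨h.1.2, h.2⟩, fun h => ⟨⟨h.2.ne', h.1⟩, h.2⟩⟩
  omega

lemma crossCount_lt_crossCount {G G' : SimpleGraph V} (hle : G' ≤ G) {A B : Finset V} {a b : V}
    (ha : a ∈ A) (hb : b ∈ B) (hab : G.Adj a b) (hab' : ¬ G'.Adj a b) :
    crossCount G' A B < crossCount G A B := by
  classical
  refine sum_lt_sum (fun x _ => card_le_card (monotone_filter_right B fun y _ h => hle h))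
    ⟨a, ha, card_lt_card ⟨monotone_filter_right B fun y _ h => hle h, fun h => ?_⟩⟩
  exact hab' (mem_filter.1 (h (mem_filter.2 ⟨hb, hab⟩))).2

lemma crossCount_le_add_two {G G' : SimpleGraph V} {a b : V}
    (h : ∀ x y, G.Adj x y → G'.Adj x y ∨ (x = a ∧ y = b) ∨ (x = b ∧ y = a)) (A B : Finset V) :
    crossCount G A B ≤ crossCount G' A B + 2 := by
  classical
  have key : ∀ x, #{y ∈ B | G.Adj x y} ≤ #{y ∈ B | G'.Adj x y} +
      ((if x = a then 1 else 0) + if x = b then 1 else 0) := by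
    intro x
    have hsub : {y ∈ B | G.Adj x y} ⊆ {y ∈ B | G'.Adj x y} ∪
        ((if x = a then {b} else ∅) ∪ if x = b then {a} else ∅) := by
      intro y hy
      rw [mem_filter] at hy
      rcases h x y hy.2 with h | ⟨h₁, h₂⟩ | ⟨h₁, h₂⟩
      · simp [hy.1, h]
      · simp [h₁, h₂]
      · simp [h₁, h₂]
    refine (card_le_card hsub).trans ((card_union_le _ _).trans ?_)
    refine Nat.add_le_add_left ((card_union_le _ _).trans ?_) _
    split_ifs <;> simp
  calc crossCount G A B ≤ _ := sum_le_sum fun x _ => key x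
    _ ≤ _ := by
      rw [sum_add_distrib, sum_add_distrib, sum_ite_eq', sum_ite_eq', crossCount]
      refine Nat.add_le_add_left ?_ _
      split_ifs <;> omega

lemma crossCount_le_add_one {G G' : SimpleGraph V} {a b : V} {A : Finset V} (hb : b ∉ A)
    (h : ∀ x y, G.Adj x y → G'.Adj x y ∨ (x = a ∧ y = b) ∨ (x = b ∧ y = a)) (B : Finset V) :
    crossCount G A B ≤ crossCount G' A B + 1 := by
  classical
  have key : ∀ x ∈ A, #{y ∈ B | G.Adj x y} ≤ #{y ∈ B | G'.Adj x y} +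
      if x = a then 1 else 0 := by
    intro x hx
    have hsub : {y ∈ B | G.Adj x y} ⊆ {y ∈ B | G'.Adj x y} ∪ if x = a then {b} else ∅ := by
      intro y hy
      rw [mem_filter] at hy
      rcases h x y hy.2 with h | ⟨h₁, h₂⟩ | ⟨h₁, h₂⟩
      · simp [hy.1, h]
      · simp [h₁, h₂]
      · exact absurd (h₁ ▸ hx) hb
    refine (card_le_card hsub).trans ((card_union_le _ _).trans ?_)
    refine Nat.add_le_add_left ?_ _
    split_ifs <;> simp
  calc crossCount G A B ≤ _ := sum_le_sum key
    _ ≤ _ := by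
      rw [sum_add_distrib, sum_ite_eq', crossCount]
      refine Nat.add_le_add_left ?_ _
      split_ifs <;> omega

/-- The graph `G` with every neighbor of `b` made adjacent to `a` as well. -/
def absorbNeighbors (G : SimpleGraph V) (a b : V) : SimpleGraph V :=
  G ⊔ SimpleGraph.fromRel fun u v => u = a ∧ G.Adj b v

lemma absorbNeighbors_adj {G : SimpleGraph V} {a b u v : V} :
    (absorbNeighbors G a b).Adj u v ↔
      G.Adj u v ∨ u ≠ v ∧ (u = a ∧ G.Adj b v ∨ v = a ∧ G.Adj b u) := by
  simp [absorbNeighbors, SimpleGraph.fromRel_adj]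

open Classical in
/-- Contracting an edge loses that edge together with one edge per triangle on it. -/
lemma crossCount_absorbNeighbors (G : SimpleGraph V) {S : Finset V} {a b : V} (ha : a ∈ S)
    (hb : b ∈ S) (hab : G.Adj a b) :
    crossCount G S S ≤ crossCount (absorbNeighbors G a b) (S.erase b) (S.erase b) + 2 +
      2 * #{v ∈ S | G.Adj a v ∧ G.Adj b v} := by
  have hne : a ≠ b := hab.ne
  have haS : a ∈ S.erase b := mem_erase.2 ⟨hne, ha⟩
  have hdel := crossCount_erase_erase G hb
  have hdeg : #{v ∈ S | G.Adj b v} ≤ 1 + #{v ∈ S | G.Adj a v ∧ G.Adj b v} +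
      #{v ∈ S.erase b | v ≠ a ∧ G.Adj b v ∧ ¬ G.Adj a v} := by
    have hsub : {v ∈ S | G.Adj b v} ⊆ ({a} ∪ {v ∈ S | G.Adj a v ∧ G.Adj b v}) ∪
        {v ∈ S.erase b | v ≠ a ∧ G.Adj b v ∧ ¬ G.Adj a v} := by
      intro v hv
      simp only [mem_filter, mem_union, mem_singleton, mem_erase] at hv ⊢
      have := hv.2.ne'
      tauto
    refine (card_le_card hsub).trans ((card_union_le _ _).trans ?_)
    refine Nat.add_le_add_right ((card_union_le _ _).trans ?_) _
    simp
  have hadd : crossCount G (S.erase b) (S.erase b) +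
      2 * #{v ∈ S.erase b | v ≠ a ∧ G.Adj b v ∧ ¬ G.Adj a v} ≤
      crossCount (absorbNeighbors G a b) (S.erase b) (S.erase b) := by
    set S' := S.erase b
    have hrow : ∀ u ∈ S'.erase a, #{v ∈ S' | G.Adj u v} +
        (if G.Adj b u ∧ ¬ G.Adj a u then 1 else 0) ≤
        #{v ∈ S' | (absorbNeighbors G a b).Adj u v} := by
      intro u hu
      rw [mem_erase] at hu
      split_ifs with h
      · rw [← card_insert_of_notMem (a := a) (s := {v ∈ S' | G.Adj u v})
          (by simp [G.adj_comm u a, h.2])]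
        refine card_le_card fun v hv => ?_
        simp only [mem_insert, mem_filter] at hv ⊢
        rw [absorbNeighbors_adj]
        rcases hv with rfl | hv
        · exact ⟨haS, Or.inr ⟨hu.1, Or.inr ⟨rfl, h.1⟩⟩⟩
        · exact ⟨hv.1, Or.inl hv.2⟩
      · exact card_le_card (monotone_filter_right _ fun v _ hv =>
          absorbNeighbors_adj.2 (Or.inl hv))
    have hrow' : #{v ∈ S' | G.Adj a v} + #{v ∈ S' | v ≠ a ∧ G.Adj b v ∧ ¬ G.Adj a v} ≤
        #{v ∈ S' | (absorbNeighbors G a b).Adj a v} := by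
      rw [← card_union_of_disjoint]
      · refine card_le_card fun v hv => ?_
        simp only [mem_union, mem_filter] at hv ⊢
        rw [absorbNeighbors_adj]
        rcases hv with hv | hv
        · exact ⟨hv.1, Or.inl hv.2⟩
        · exact ⟨hv.1, Or.inr ⟨hv.2.1.symm, Or.inl ⟨rfl, hv.2.2.1⟩⟩⟩
      · rw [disjoint_filter]
        exact fun v _ h₁ h₂ => h₂.2.2 h₁
    have hcount : #{v ∈ S' | v ≠ a ∧ G.Adj b v ∧ ¬ G.Adj a v} =
        ∑ u ∈ S'.erase a, if G.Adj b u ∧ ¬ G.Adj a u then 1 else 0 := by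
      rw [← card_filter]
      congr 1
      ext v
      simp only [mem_filter, mem_erase]
      tauto
    have hsum := sum_le_sum hrow
    rw [sum_add_distrib, ← hcount] at hsum
    have e₁ := sum_erase_add S' (fun u => #{v ∈ S' | G.Adj u v}) haS
    have e₂ := sum_erase_add S' (fun u => #{v ∈ S' | (absorbNeighbors G a b).Adj u v}) haS
    unfold crossCount
    omega
  omega

lemma hasMinorOn_completeGraph_of_clique {G : SimpleGraph V} {S T : Finset V} (hT : T ⊆ S)
    (hcard : 5 ≤ #T) (hclique : ∀ u ∈ T, ∀ v ∈ T, u ≠ v → G.Adj u v) :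
    HasMinorOn G S (completeGraph (Fin 5)) := by
  obtain ⟨e⟩ := Function.Embedding.nonempty_of_card_le (α := Fin 5) (β := T) (by simpa using hcard)
  refine ⟨fun i => {(e i : V)}, fun i => ?_, fun i => cutConnected_singleton G _, fun i j h => ?_,
    fun i j h => ⟨e i, rfl, e j, rfl, hclique _ (e i).2 _ (e j).2 ?_⟩⟩
  · simpa using hT (e i).2
  · simpa [Subtype.ext_iff] using fun h' => h (e.injective (Subtype.ext h'))
  · exact fun h' => h (e.injective (Subtype.ext h'))

/-- A vertex `v` joined to all of `x, y, p, q, r`, where `x` and `y` are joined to the path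
`p - q - r`, yields a `K₅` minor. -/
lemma hasMinorOn_completeGraph_of_wheel {G : SimpleGraph V} {S : Set V} {v x y p q r : V}
    (hS : ∀ z ∈ ([v, x, y, p, q, r] : List V), z ∈ S)
    (hnodup : [v, x, y, p, q, r].Nodup)
    (hvx : G.Adj v x) (hvp : G.Adj v p) (hvq : G.Adj v q) (hvr : G.Adj v r)
    (hxp : G.Adj x p) (hxq : G.Adj x q) (hxr : G.Adj x r) (hyp : G.Adj y p)
    (hyr : G.Adj y r) (hpq : G.Adj p q) (hqr : G.Adj q r) :
    HasMinorOn G S (completeGraph (Fin 5)) := by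
  simp only [List.mem_cons, List.not_mem_nil, or_false, forall_eq_or_imp, forall_eq] at hS
  obtain ⟨hv, hx, hy, hp, hq, hr⟩ := hS
  simp only [List.nodup_cons, List.mem_cons, List.not_mem_nil, or_false, not_or] at hnodup
  obtain ⟨⟨d₁, d₂, d₃, d₄, d₅⟩, ⟨d₆, d₇, d₈, d₉⟩, ⟨d₁₀, d₁₁, d₁₂⟩, ⟨d₁₃, d₁₄⟩, d₁₅, -⟩ := hnodup
  let f : Fin 5 → Set V := ![{v}, {q}, {x}, {p}, {r, y}]
  have hlt : ∀ i j : Fin 5, i < j → Disjoint (f i) (f j) ∧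
      ∃ a ∈ f i, ∃ b ∈ f j, G.Adj a b := by
    intro i j hij
    fin_cases i <;> fin_cases j <;> first | (exact absurd hij (by decide)) | skip
    all_goals simp [f, *, eq_comm, G.adj_comm]
  refine ⟨f, fun i => ?_, fun i => ?_, fun i j h => ?_, fun i j h => ?_⟩
  · fin_cases i <;> simp [f, Set.insert_subset_iff, *]
  · fin_cases i
    · exact cutConnected_singleton G _
    · exact cutConnected_singleton G _
    · exact cutConnected_singleton G _
    · exact cutConnected_singleton G _
    · exact cutConnected_insert (cutConnected_singleton G y) rfl hyr.symm
  · rcases lt_or_gt_of_ne h with h | h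
    · exact (hlt i j h).1
    · exact (hlt j i h).1.symm
  · rcases lt_or_gt_of_ne h.ne with h | h
    · exact (hlt i j h).2
    · obtain ⟨a, ha, b, hb, hab⟩ := (hlt j i h).2
      exact ⟨b, hb, a, ha, hab.symm⟩

open Classical in
/-- The local step of Mader's bound: a vertex of degree between `1` and `5` all of whose edges lie
in at least three triangles is contained in a `K₅` minor. -/
lemma hasMinorOn_completeGraph_of_triangles {G : SimpleGraph V} {S : Finset V} {v : V}
    (hv : v ∈ S) (hpos : 0 < #{u ∈ S | G.Adj v u}) (hdeg : #{u ∈ S | G.Adj v u} ≤ 5)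
    (htri : ∀ u ∈ S, G.Adj v u → 3 ≤ #{w ∈ S | G.Adj u w ∧ G.Adj v w}) :
    HasMinorOn G S (completeGraph (Fin 5)) := by
  set N := {u ∈ S | G.Adj v u} with hN
  have hNmem : ∀ u, u ∈ N ↔ u ∈ S ∧ G.Adj v u := fun u => mem_filter
  have htri' : ∀ u ∈ N, 3 ≤ #{w ∈ N | G.Adj u w} := by
    intro u hu
    rw [hNmem] at hu
    refine (htri u hu.1 hu.2).trans (card_le_card fun w hw => ?_)
    simp only [mem_filter, hNmem] at hw ⊢
    tauto
  have hcard : 4 ≤ #N := by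
    obtain ⟨u, hu⟩ := card_pos.1 hpos
    have h := card_le_card (s := {w ∈ N | G.Adj u w}) (t := N.erase u) (fun w hw => by
      rw [mem_filter] at hw
      exact mem_erase.2 ⟨hw.2.ne', hw.1⟩)
    rw [card_erase_of_mem hu] at h
    have := htri' u hu
    omega
  by_cases hclique : ∀ u ∈ N, ∀ w ∈ N, u ≠ w → G.Adj u w
  · have hvN : v ∉ N := fun h => ((hNmem v).1 h).2.ne rfl
    refine hasMinorOn_completeGraph_of_clique (T := insert v N) (fun u hu => ?_)
      (by rw [card_insert_of_notMem hvN]; omega) ?_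
    · rcases mem_insert.1 hu with rfl | h
      · exact hv
      · exact ((hNmem u).1 h).1
    · intro u hu w hw huw
      rcases mem_insert.1 hu with rfl | hu <;> rcases mem_insert.1 hw with rfl | hw
      · exact absurd rfl huw
      · exact ((hNmem w).1 hw).2
      · exact ((hNmem u).1 hu).2.symm
      · exact hclique u hu w hw huw
  push Not at hclique
  obtain ⟨x, hx, y, hy, hxy, hnxy⟩ := hclique
  have hM : #((N.erase x).erase y) ≤ 3 := by
    rw [card_erase_of_mem (mem_erase.2 ⟨hxy.symm, hy⟩), card_erase_of_mem hx]
    omega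
  have hfull : ∀ z ∈ N, (z = x ∨ z = y) → {w ∈ N | G.Adj z w} = (N.erase x).erase y := by
    intro z hz hzxy
    refine eq_of_subset_of_card_le (fun w hw => ?_) (hM.trans (htri' z hz))
    rw [mem_filter] at hw
    refine mem_erase.2 ⟨?_, mem_erase.2 ⟨?_, hw.1⟩⟩
    · rintro rfl
      rcases hzxy with rfl | rfl
      · exact hnxy hw.2
      · exact hw.2.ne rfl
    · rintro rfl
      rcases hzxy with rfl | rfl
      · exact hw.2.ne rfl
      · exact hnxy hw.2.symm
  have hMx := hfull x hx (Or.inl rfl)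
  have hMy := hfull y hy (Or.inr rfl)
  obtain ⟨p, q, r, hpq, hpr, hqr, hM'⟩ := card_eq_three.1
    (le_antisymm hM (hMx ▸ htri' x hx))
  rw [hM'] at hMx hMy
  have hxM : ∀ w, w = p ∨ w = q ∨ w = r → w ∈ N ∧ G.Adj x w := fun w hw => by
    have : w ∈ ({p, q, r} : Finset V) := by simpa using hw
    rwa [← hMx, mem_filter] at this
  have hyM : ∀ w, w = p ∨ w = q ∨ w = r → w ∈ N ∧ G.Adj y w := fun w hw => by
    have : w ∈ ({p, q, r} : Finset V) := by simpa using hw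
    rwa [← hMy, mem_filter] at this
  have hNsub : ∀ w ∈ N, w = x ∨ w = y ∨ w = p ∨ w = q ∨ w = r := by
    intro w hw
    by_cases h₁ : w = x
    · exact Or.inl h₁
    by_cases h₂ : w = y
    · exact Or.inr (Or.inl h₂)
    have : w ∈ (N.erase x).erase y := mem_erase.2 ⟨h₂, mem_erase.2 ⟨h₁, hw⟩⟩
    rw [hM'] at this
    simpa using Or.inr (Or.inr this)
  have hinner : ∀ a b c, a ∈ N → (∀ w ∈ N, w = x ∨ w = y ∨ w = a ∨ w = b ∨ w = c) →
      G.Adj a b ∨ G.Adj a c := by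
    intro a b c ha hsub
    by_contra! hno
    have h := card_le_card (s := {w ∈ N | G.Adj a w}) (t := {x, y}) (fun w hw => by
      rw [mem_filter] at hw
      rcases hsub w hw.1 with rfl | rfl | rfl | rfl | rfl
      · simp
      · simp
      · exact absurd rfl hw.2.ne
      · exact absurd hw.2 hno.1
      · exact absurd hw.2 hno.2)
    have := htri' a ha
    have := card_le_two (a := x) (b := y)
    omega
  obtain ⟨hpN, hxp⟩ := hxM p (by simp)
  obtain ⟨hqN, hxq⟩ := hxM q (by simp)
  obtain ⟨hrN, hxr⟩ := hxM r (by simp)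
  have hyp := (hyM p (by simp)).2
  have hyq := (hyM q (by simp)).2
  have hyr := (hyM r (by simp)).2
  rw [hNmem] at hx hy hpN hqN hrN
  have h₁ := hinner p q r ((hNmem p).2 hpN) (fun w hw => by have := hNsub w hw; tauto)
  have h₂ := hinner q p r ((hNmem q).2 hqN) (fun w hw => by have := hNsub w hw; tauto)
  have h₃ := hinner r p q ((hNmem r).2 hrN) (fun w hw => by have := hNsub w hw; tauto)
  have wheel : ∀ a b c, (a ∈ S ∧ G.Adj v a) → (b ∈ S ∧ G.Adj v b) → (c ∈ S ∧ G.Adj v c) →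
      G.Adj x a → G.Adj x b → G.Adj x c → G.Adj y a → G.Adj y b → G.Adj y c → a ≠ c →
      G.Adj a b → G.Adj b c →
      HasMinorOn G S (completeGraph (Fin 5)) := by
    intro a b c ha hb hc hxa hxb hxc hya hyb hyc hac hab hbc
    refine hasMinorOn_completeGraph_of_wheel (v := v) (x := x) (y := y) (p := a) (q := b)
      (r := c) ?_ ?_ hx.2 ha.2 hb.2 hc.2 hxa hxb hxc hya hyc hab hbc
    · simp [hv, hx.1, hy.1, ha.1, hb.1, hc.1]
    · simp [hx.2.ne, hy.2.ne, ha.2.ne, hb.2.ne, hc.2.ne, hxy, hxa.ne, hxb.ne, hxc.ne, hya.ne,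
        hyb.ne, hyc.ne, hac, hab.ne, hbc.ne]
  by_cases hpq' : G.Adj p q
  · by_cases hqr' : G.Adj q r
    · exact wheel p q r hpN hqN hrN hxp hxq hxr hyp hyq hyr hpr hpq' hqr'
    · have : G.Adj r p := by
        rcases h₃ with h | h
        · exact h
        · exact absurd h.symm hqr'
      exact wheel q p r hqN hpN hrN hxq hxp hxr hyq hyp hyr hqr hpq'.symm this.symm
  · have hpr' : G.Adj p r := by tauto
    have hqr' : G.Adj q r := by
      rcases h₂ with h | h
      · exact absurd h.symm hpq'
      · exact h
    exact wheel p r q hpN hrN hqN hxp hxr hxq hyp hyr hyq hpq hpr' hqr'.symm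

/-- A nonempty set of `n` vertices spanning no `K₅` minor spans at most `3 n - 3` edges. -/
theorem crossCount_self_add_six_le {G : SimpleGraph V} {S : Finset V} (hS : S.Nonempty)
    (h : ¬ HasMinorOn G S (completeGraph (Fin 5))) : crossCount G S S + 6 ≤ 6 * #S := by
  classical
  induction hn : #S using Nat.strong_induction_on generalizing G S with
  | _ n ih =>
  induction hm : crossCount G S S using Nat.strong_induction_on generalizing G with
  | _ m ih' =>
  subst hn hm
  by_contra! hlt
  have hsmall : crossCount G S S < 6 * #S := by
    by_contra! hge
    have hpos : 0 < crossCount G S S := by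
      have := card_pos.2 hS
      omega
    obtain ⟨a, ha, b, hb, hab⟩ : ∃ a ∈ S, ∃ b ∈ S, G.Adj a b := by
      by_contra! hno
      refine hpos.ne' (sum_eq_zero fun a ha => card_eq_zero.2 (filter_eq_empty_iff.2 ?_))
      exact fun b hb => hno a ha b hb
    let G' := G.deleteEdges {s(a, b)}
    have hle : G' ≤ G := deleteEdges_le _
    have h₁ := crossCount_lt_crossCount hle ha hb hab (by simp [G', deleteEdges_adj])
    have h₂ := crossCount_le_add_two (G := G) (G' := G') (a := a) (b := b) (fun x y hxy => by
      simp only [G', deleteEdges_adj, hxy, true_and, Set.mem_singleton_iff, Sym2.eq_iff]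
      tauto) S S
    have := ih' _ h₁ (fun hm => h (hm.mono hle subset_rfl)) rfl
    omega
  obtain ⟨v, hv, hdeg⟩ : ∃ v ∈ S, #{u ∈ S | G.Adj v u} ≤ 5 := by
    by_contra! hno
    have := card_nsmul_le_sum S (fun v => #{u ∈ S | G.Adj v u}) 6 (fun v hv => hno v hv)
    rw [smul_eq_mul] at this
    unfold crossCount at hsmall
    omega
  have herase : ∀ b ∈ S, 2 ≤ #S → (S.erase b).Nonempty := fun b hb h => by
    rw [← card_pos, card_erase_of_mem hb]
    omega
  rcases Nat.eq_zero_or_pos #{u ∈ S | G.Adj v u} with h0 | hpos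
  · have h₁ := crossCount_erase_erase G hv
    have hc := card_pos.2 hS
    rw [h0] at h₁
    rcases Nat.lt_or_ge #S 2 with h2 | h2
    · have : S.erase v = ∅ := by
        rw [← card_eq_zero, card_erase_of_mem hv]
        omega
      rw [this] at h₁
      simp [crossCount] at h₁ hlt
      omega
    · have hcard := card_erase_of_mem hv
      have := ih _ (by omega) (herase v hv h2) (fun hm => h (hm.mono le_rfl (by simp))) rfl
      omega
  · refine h (hasMinorOn_completeGraph_of_triangles hv hpos hdeg fun u hu hvu => ?_)
    by_contra! ht
    have h2 : 2 ≤ #S := by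
      have : #({u, v} : Finset V) ≤ #S := card_le_card (by
        intro w hw
        rcases mem_insert.1 hw with rfl | hw
        · exact hu
        · exact mem_singleton.1 hw ▸ hv)
      rwa [card_pair hvu.ne'] at this
    have hc := crossCount_absorbNeighbors G hu hv hvu.symm
    have hcard := card_erase_of_mem hv
    have hgoal : crossCount (absorbNeighbors G u v) (S.erase v) (S.erase v) + 6 ≤
        6 * #(S.erase v) := by
      refine ih _ (by omega) (herase v hv h2) (fun hm => h ?_) rfl
      rw [coe_erase] at hm
      refine hm.of_contract (Set.singleton_subset_iff.2 hv)
        (cutConnected_insert (cutConnected_singleton G v) rfl hvu.symm) fun x y hxy => ?_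
      rw [absorbNeighbors_adj] at hxy
      rcases hxy with h | ⟨-, ⟨h₁, h₂⟩ | ⟨h₁, h₂⟩⟩
      · exact Or.inl h
      · exact Or.inr (Or.inl ⟨h₁, v, rfl, h₂⟩)
      · exact Or.inr (Or.inr ⟨h₁, v, rfl, h₂.symm⟩)
    omega

/-- `A` and `B` are disjoint independent sets of `G`. -/
structure IsBipartition (G : SimpleGraph V) (A B : Finset V) : Prop where
  disjoint : Disjoint A B
  left : ∀ u ∈ A, ∀ v ∈ A, ¬ G.Adj u v
  right : ∀ u ∈ B, ∀ v ∈ B, ¬ G.Adj u v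

lemma IsBipartition.symm {G : SimpleGraph V} {A B : Finset V} (h : IsBipartition G A B) :
    IsBipartition G B A :=
  ⟨h.disjoint.symm, h.right, h.left⟩

lemma IsBipartition.mono {G : SimpleGraph V} {A B A' B' : Finset V} (h : IsBipartition G A B)
    (hA : A' ⊆ A) (hB : B' ⊆ B) : IsBipartition G A' B' :=
  ⟨disjoint_of_subset_left hA (disjoint_of_subset_right hB h.disjoint),
    fun u hu v hv => h.left u (hA hu) v (hA hv), fun u hu v hv => h.right u (hB hu) v (hB hv)⟩

open Classical in
/-- Identifying `a` and `b` in `B` loses one edge per common neighbor. -/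
lemma crossCount_absorbNeighbors_left (G : SimpleGraph V) {A B : Finset V} {a b : V}
    (ha : a ∈ B) (hb : b ∈ B) (hab : a ≠ b) (haA : a ∉ A) :
    crossCount G B A ≤ crossCount (absorbNeighbors G a b) (B.erase b) A +
      #{v ∈ A | G.Adj a v ∧ G.Adj b v} := by
  set G' := absorbNeighbors G a b with hG'
  have haB : a ∈ B.erase b := mem_erase.2 ⟨hab, ha⟩
  have e₀ := crossCount_erase_left G A hb
  have e₁ := crossCount_erase_left G A haB
  have e₂ := crossCount_erase_left G' A haB
  have hle : crossCount G ((B.erase b).erase a) A ≤ crossCount G' ((B.erase b).erase a) A :=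
    sum_le_sum fun u _ => card_le_card (monotone_filter_right A fun v _ hv =>
      absorbNeighbors_adj.2 (Or.inl hv))
  have hrow : #{v ∈ A | G.Adj a v} + #{v ∈ A | G.Adj b v} ≤
      #{v ∈ A | G'.Adj a v} + #{v ∈ A | G.Adj a v ∧ G.Adj b v} := by
    rw [← card_union_add_card_inter, ← filter_and]
    refine Nat.add_le_add_right (card_le_card fun v hv => ?_) _
    simp only [mem_union, mem_filter] at hv ⊢
    rw [hG', absorbNeighbors_adj]
    rcases hv with hv | hv
    · exact ⟨hv.1, Or.inl hv.2⟩
    · exact ⟨hv.1, Or.inr ⟨fun h => haA (h ▸ hv.1), Or.inl ⟨rfl, hv.2⟩⟩⟩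
  omega

open Classical in
lemma crossCount_eq_card_filter (G : SimpleGraph V) (A B : Finset V) :
    crossCount G A B = #{p ∈ A ×ˢ B | G.Adj p.1 p.2} := by
  simp only [crossCount, card_filter, sum_product]

/-- If no edge joins the two sides of a cut through the path `y - x - z`, the two edges of the path
are counted on both sides. -/
lemma crossCount_add_two_le_of_cut {G : SimpleGraph V} {A B A₁ B₁ A₂ B₂ : Finset V} {x y z : V}
    (hcover : ∀ u ∈ A, ∀ v ∈ B, G.Adj u v → (u ∈ A₁ ∧ v ∈ B₁) ∨ (u ∈ A₂ ∧ v ∈ B₂))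
    (hx : x ∈ A₁ ∧ x ∈ A₂) (hy : y ∈ B₁ ∧ y ∈ B₂) (hz : z ∈ B₁ ∧ z ∈ B₂) (hyz : y ≠ z)
    (hxy : G.Adj x y) (hxz : G.Adj x z) :
    crossCount G A B + 2 ≤ crossCount G A₁ B₁ + crossCount G A₂ B₂ := by
  classical
  rw [crossCount_eq_card_filter, crossCount_eq_card_filter, crossCount_eq_card_filter,
    ← card_union_add_card_inter]
  refine Nat.add_le_add (card_le_card fun p hp => ?_) ?_
  · simp only [mem_filter, mem_product, mem_union] at hp ⊢
    have := hcover p.1 hp.1.1 p.2 hp.1.2 hp.2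
    tauto
  · rw [← card_pair (a := (x, y)) (b := (x, z)) (by simpa using hyz)]
    refine card_le_card fun p hp => ?_
    simp only [mem_insert, mem_singleton] at hp
    simp only [mem_inter, mem_filter, mem_product]
    rcases hp with rfl | rfl
    · exact ⟨⟨⟨hx.1, hy.1⟩, hxy⟩, ⟨hx.2, hy.2⟩, hxy⟩
    · exact ⟨⟨⟨hx.1, hz.1⟩, hxz⟩, ⟨hx.2, hz.2⟩, hxz⟩

/-- Three vertices `b₁`, `b₂`, `Z` (a connected set) on one side and `a`, `c`, `c'` on the other
form a `K₃,₃` minor. -/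
lemma hasMinorOn_completeBipartiteGraph {G : SimpleGraph V} {S Z : Set V} {b₁ b₂ a c c' : V}
    (hS : ∀ v ∈ ([b₁, b₂, a, c, c'] : List V), v ∈ S) (hZS : Z ⊆ S) (hZ : CutConnected G Z)
    (hnodup : [b₁, b₂, a, c, c'].Nodup) (hZd : ∀ v ∈ ([b₁, b₂, a, c, c'] : List V), v ∉ Z)
    (h₁ : ∀ v ∈ ([a, c, c'] : List V), G.Adj b₁ v)
    (h₂ : ∀ v ∈ ([a, c, c'] : List V), G.Adj b₂ v)
    (h₃ : ∀ v ∈ ([a, c, c'] : List V), ∃ z ∈ Z, G.Adj z v) :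
    HasMinorOn G S (completeBipartiteGraph (Fin 3) (Fin 3)) := by
  simp only [List.mem_cons, List.not_mem_nil, or_false, forall_eq_or_imp, forall_eq]
    at hS hZd h₁ h₂ h₃
  simp only [List.nodup_cons, List.mem_cons, List.not_mem_nil, or_false, not_or] at hnodup
  obtain ⟨⟨d₁, d₂, d₃, d₄⟩, ⟨d₅, d₆, d₇⟩, ⟨d₈, d₉⟩, d₁₀, -⟩ := hnodup
  obtain ⟨s₁, s₂, s₃, s₄, s₅⟩ := hS
  obtain ⟨z₁, z₂, z₃, z₄, z₅⟩ := hZd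
  let f : Fin 3 → Set V := ![{b₁}, {b₂}, Z]
  let g : Fin 3 → Set V := ![{a}, {c}, {c'}]
  have hadj : ∀ i j, ∃ u ∈ f i, ∃ v ∈ g j, G.Adj u v := by
    intro i j
    fin_cases i <;> fin_cases j <;> simp [f, g, h₁, h₂, h₃]
  have hfg : ∀ i j, Disjoint (f i) (g j) := by
    intro i j
    fin_cases i <;> fin_cases j <;> simp [f, g, *]
  have hff : ∀ i j, i ≠ j → Disjoint (f i) (f j) := by
    intro i j hij
    fin_cases i <;> fin_cases j <;> first | exact absurd rfl hij | simp [f, *, Ne.symm d₁]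
  have hgg : ∀ i j, i ≠ j → Disjoint (g i) (g j) := by
    intro i j hij
    fin_cases i <;> fin_cases j <;>
      first | exact absurd rfl hij | simp [g, *, Ne.symm d₈, Ne.symm d₉, Ne.symm d₁₀]
  refine ⟨Sum.elim f g, ?_, ?_, ?_, ?_⟩
  · rintro (i | i)
    · fin_cases i <;> simp [f, *]
    · fin_cases i <;> simp [g, *]
  · rintro (i | i)
    · fin_cases i
      · exact cutConnected_singleton G _
      · exact cutConnected_singleton G _
      · exact hZ
    · fin_cases i <;> exact cutConnected_singleton G _
  · rintro (i | i) (j | j) hij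
    · exact hff i j fun h => hij (h ▸ rfl)
    · exact hfg i j
    · exact (hfg j i).symm
    · exact hgg i j fun h => hij (h ▸ rfl)
  · rintro (i | i) (j | j) hij
    · simp [completeBipartiteGraph] at hij
    · exact hadj i j
    · obtain ⟨u, hu, v, hv, huv⟩ := hadj j i
      exact ⟨v, hv, u, hu, huv.symm⟩
    · simp [completeBipartiteGraph] at hij

/-- The bound `e ≤ 2 n - 4` for bipartite graphs without `K₃,₃` minor, for one instance. -/
def SatisfiesBipartiteBound (G : SimpleGraph V) (A B : Finset V) : Prop :=
  IsBipartition G A B → 3 ≤ #A + #B →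
    ¬ HasMinorOn G (A ∪ B : Set V) (completeBipartiteGraph (Fin 3) (Fin 3)) →
    crossCount G A B + 4 ≤ 2 * (#A + #B)

/-- In a minimal violation of the bipartite bound, removing a path `y - x - z` leaves the graph
connected. -/
lemma cutConnected_of_minimal {G : SimpleGraph V} {A B : Finset V}
    (ih : ∀ A' B', #A' + #B' < #A + #B → SatisfiesBipartiteBound G A' B')
    (hbip : IsBipartition G A B)
    (hminor : ¬ HasMinorOn G (A ∪ B : Set V) (completeBipartiteGraph (Fin 3) (Fin 3)))
    (hcount : 2 * (#A + #B) < crossCount G A B + 4) {x y z w : V} (hx : x ∈ A) (hy : y ∈ B)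
    (hz : z ∈ B) (hyz : y ≠ z) (hxy : G.Adj x y) (hxz : G.Adj x z)
    (hw : w ∈ ((A ∪ B : Set V) \ {x, y, z})) :
    CutConnected G ((A ∪ B : Set V) \ {x, y, z}) := by
  classical
  refine ⟨⟨w, hw⟩, fun P ⟨p, hp, hpP⟩ ⟨q, hq, hqP⟩ => ?_⟩
  by_contra! hno
  let K : Set V := {x, y, z}
  have hxB : x ∉ B := fun h => (disjoint_left.1 hbip.disjoint) hx h
  have hyA : y ∉ A := fun h => (disjoint_left.1 hbip.disjoint) h hy
  have hzA : z ∉ A := fun h => (disjoint_left.1 hbip.disjoint) h hz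
  have hxK : x ∈ K := Or.inl rfl
  have hyK : y ∈ K := Or.inr (Or.inl rfl)
  have hzK : z ∈ K := Or.inr (Or.inr rfl)
  -- the part of a set on either side of the cut
  let side : Set V → Finset V → Finset V := fun Q X => {v ∈ X | v ∈ Q ∨ v ∈ K}
  have hmem : ∀ Q X v, v ∈ side Q X ↔ v ∈ X ∧ (v ∈ Q ∨ v ∈ K) := fun Q X v => mem_filter
  have hsub : ∀ Q X, side Q X ⊆ X := fun Q X => filter_subset _ _
  have hcard : ∀ X, #(side P X) + #(side Pᶜ X) = #X + #{v ∈ X | v ∈ K} := by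
    intro X
    rw [← card_union_add_card_inter]
    congr 2
    · ext v
      simp only [mem_union, hmem, Set.mem_compl_iff]
      tauto
    · ext v
      simp only [mem_inter, hmem, mem_filter, Set.mem_compl_iff]
      tauto
  have hKA : #{v ∈ A | v ∈ K} = 1 := by
    rw [card_eq_one]
    refine ⟨x, ?_⟩
    ext v
    simp only [mem_filter, mem_singleton]
    constructor
    · rintro ⟨hv, rfl | rfl | rfl⟩
      · rfl
      · exact absurd hv hyA
      · exact absurd hv hzA
    · rintro rfl
      exact ⟨hx, hxK⟩
  have hKB : #{v ∈ B | v ∈ K} = 2 := by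
    rw [card_eq_two]
    refine ⟨y, z, hyz, ?_⟩
    ext v
    simp only [mem_filter, mem_insert, mem_singleton]
    constructor
    · rintro ⟨hv, rfl | rfl | rfl⟩
      · exact absurd hv hxB
      · exact Or.inl rfl
      · exact Or.inr rfl
    · rintro (rfl | rfl)
      · exact ⟨hy, hyK⟩
      · exact ⟨hz, hzK⟩
  have hside : ∀ (Q : Set V) v, v ∈ ((A ∪ B : Set V) \ {x, y, z}) → v ∉ Q →
      crossCount G (side Q A) (side Q B) + 4 ≤ 2 * (#(side Q A) + #(side Q B)) := by
    intro Q v hv hvQ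
    have hvK : v ∉ K := hv.2
    have hA := card_le_card (hsub Q A)
    have hB := card_le_card (hsub Q B)
    refine ih _ _ ?_ (hbip.mono (hsub Q A) (hsub Q B)) ?_
      (fun h => hminor (h.mono le_rfl (Set.union_subset_union (by simpa using hsub Q A)
        (by simpa using hsub Q B))))
    · rcases hv.1 with h | h
      · have : #(side Q A) < #A := card_lt_card ⟨hsub Q A, fun h' => by
          have := (hmem Q A v).1 (h' h)
          tauto⟩
        omega
      · have : #(side Q B) < #B := card_lt_card ⟨hsub Q B, fun h' => by
          have := (hmem Q B v).1 (h' h)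
          tauto⟩
        omega
    · have h₁ : #{v ∈ A | v ∈ K} ≤ #(side Q A) :=
        card_le_card (monotone_filter_right A fun _ _ h => Or.inr h)
      have h₂ : #{v ∈ B | v ∈ K} ≤ #(side Q B) :=
        card_le_card (monotone_filter_right B fun _ _ h => Or.inr h)
      omega
  have h₁ := hside P q hq hqP
  have h₂ := hside Pᶜ p hp (fun h => h hpP)
  have h₃ : crossCount G A B + 2 ≤
      crossCount G (side P A) (side P B) + crossCount G (side Pᶜ A) (side Pᶜ B) := by
    refine crossCount_add_two_le_of_cut (x := x) (y := y) (z := z) (fun u hu v hv huv => ?_)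
      ?_ ?_ ?_ hyz hxy hxz
    · simp only [hmem, hu, hv, true_and, Set.mem_compl_iff]
      by_cases huK : u ∈ K
      · tauto
      by_cases hvK : v ∈ K
      · tauto
      have h₁ : u ∈ P → v ∈ P := fun h => by
        by_contra h'
        exact hno u ⟨⟨Or.inl hu, huK⟩, h⟩ v ⟨⟨Or.inr hv, hvK⟩, h'⟩ huv
      have h₂ : v ∈ P → u ∈ P := fun h => by
        by_contra h'
        exact hno v ⟨⟨Or.inr hv, hvK⟩, h⟩ u ⟨⟨Or.inl hu, huK⟩, h'⟩ huv.symm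
      tauto
    · simp [hmem, hx, hxK]
    · simp [hmem, hy, hyK]
    · simp [hmem, hz, hzK]
  have h₄ := hcard A
  have h₅ := hcard B
  omega

open Classical in
/-- A minimal violation of the bipartite bound has no vertex of degree three. -/
lemma hasMinorOn_of_degree_three {G : SimpleGraph V} {A B : Finset V}
    (ih : ∀ (G' : SimpleGraph V) A' B', #A' + #B' < #A + #B → SatisfiesBipartiteBound G' A' B')
    (hbip : IsBipartition G A B) (hcard : 5 ≤ #A + #B)
    (hcount : 2 * (#A + #B) < crossCount G A B + 4) {a : V} (ha : a ∈ A)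
    (hdeg : #{b ∈ B | G.Adj a b} = 3) :
    HasMinorOn G (A ∪ B : Set V) (completeBipartiteGraph (Fin 3) (Fin 3)) := by
  by_contra hminor
  have hAB : ∀ u ∈ A, u ∉ B := fun u hu => (disjoint_left.1 hbip.disjoint) hu
  have hBA : ∀ u ∈ B, u ∉ A := fun u hu hu' => hAB u hu' hu
  obtain ⟨b₁, b₂, b₃, h₁₂, h₁₃, h₂₃, hN⟩ := card_eq_three.1 hdeg
  have hNmem : ∀ b, (b ∈ B ∧ G.Adj a b) ↔ b = b₁ ∨ b = b₂ ∨ b = b₃ := fun b => by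
    rw [← mem_filter (p := fun b => G.Adj a b), hN]
    simp
  obtain ⟨hb₁, hab₁⟩ := (hNmem b₁).2 (by simp)
  obtain ⟨hb₂, hab₂⟩ := (hNmem b₂).2 (by simp)
  obtain ⟨hb₃, hab₃⟩ := (hNmem b₃).2 (by simp)
  have hcommon : 2 ≤ #{v ∈ A.erase a | G.Adj b₁ v ∧ G.Adj b₂ v} := by
    have hloss := crossCount_absorbNeighbors_left G (A := A.erase a) hb₁ hb₂ h₁₂
      (fun h => hBA b₁ hb₁ (mem_of_mem_erase h))
    have hdel := crossCount_erase_left G B ha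
    have hA := card_erase_of_mem ha
    have hB := card_erase_of_mem hb₂
    have hA0 := card_pos.2 ⟨a, ha⟩
    have hB0 := card_pos.2 ⟨b₂, hb₂⟩
    have hsat := ih (absorbNeighbors G b₁ b₂) (A.erase a) (B.erase b₂) (by omega)
      ⟨(hbip.mono (erase_subset _ _) (erase_subset _ _)).disjoint, ?_, ?_⟩ (by omega) ?_
    · rw [crossCount_comm] at hsat
      rw [crossCount_comm G B] at hloss
      omega
    · intro u hu v hv huv
      have hu := mem_of_mem_erase hu
      have hv := mem_of_mem_erase hv
      rcases absorbNeighbors_adj.1 huv with h | ⟨-, ⟨rfl, -⟩ | ⟨rfl, -⟩⟩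
      · exact hbip.left u hu v hv h
      · exact hBA u hb₁ hu
      · exact hBA v hb₁ hv
    · intro u hu v hv huv
      have hu := mem_of_mem_erase hu
      have hv := mem_of_mem_erase hv
      rcases absorbNeighbors_adj.1 huv with h | ⟨-, ⟨rfl, h⟩ | ⟨rfl, h⟩⟩
      · exact hbip.right u hu v hv h
      · exact hbip.right _ hb₂ v hv h
      · exact hbip.right _ hb₂ u hu h
    · intro h
      have hS : ((A.erase a : Finset V) ∪ (B.erase b₂ : Finset V) : Set V) ⊆
          (A ∪ B : Set V) \ {a, b₂} := by
        rintro v (hv | hv)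
        · have hv := mem_erase.1 hv
          refine ⟨Or.inl hv.2, ?_⟩
          rintro (rfl | rfl)
          · exact hv.1 rfl
          · exact hBA v hb₂ hv.2
        · have hv := mem_erase.1 hv
          refine ⟨Or.inr hv.2, ?_⟩
          rintro (rfl | rfl)
          · exact hAB v ha hv.2
          · exact hv.1 rfl
      refine hminor ((h.mono le_rfl hS).of_contract (b := b₁) ?_ ?_ fun u v huv => ?_)
      · rintro v (rfl | rfl)
        · exact Or.inl ha
        · exact Or.inr hb₂
      · exact cutConnected_insert (cutConnected_insert (cutConnected_singleton G b₂) rfl hab₂)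
          (Or.inl rfl) hab₁.symm
      · rcases absorbNeighbors_adj.1 huv with h | ⟨-, ⟨h₁, h₂⟩ | ⟨h₁, h₂⟩⟩
        · exact Or.inl h
        · exact Or.inr (Or.inl ⟨h₁, b₂, Or.inr rfl, h₂⟩)
        · exact Or.inr (Or.inr ⟨h₁, b₂, Or.inr rfl, h₂.symm⟩)
  obtain ⟨c, hc, c', hc', hcc'⟩ := one_lt_card.1 (show 1 < _ from hcommon)
  simp only [mem_filter, mem_erase] at hc hc'
  obtain ⟨⟨hca, hcA⟩, hbc₁, hbc₂⟩ := hc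
  obtain ⟨⟨hca', hcA'⟩, hbc₁', hbc₂'⟩ := hc'
  have hneAB : ∀ u ∈ A, ∀ v ∈ B, u ≠ v := fun u hu v hv h => hAB u hu (h ▸ hv)
  let W : Set V := (A ∪ B : Set V) \ {a, b₁, b₂, c, c'}
  have hb₃W : b₃ ∈ W := by
    refine ⟨Or.inr hb₃, ?_⟩
    simp only [Set.mem_insert_iff, Set.mem_singleton_iff, not_or]
    exact ⟨(hneAB a ha b₃ hb₃).symm, h₁₃.symm, h₂₃.symm, (hneAB c hcA b₃ hb₃).symm,
      (hneAB c' hcA' b₃ hb₃).symm⟩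
  obtain ⟨Z, hZW, hb₃Z, hZ, hclosed⟩ := exists_cutConnected_component G W hb₃W
  have hZnot : ∀ v ∈ W, v ∉ ({a, b₁, b₂, c, c'} : Set V) := fun v hv => hv.2
  have htouch : ∀ d d', d ∈ A → d' ∈ A → d ≠ a → d' ≠ a → d ≠ d' → G.Adj b₁ d → G.Adj b₂ d →
      (∀ v, v = d ∨ v = d' ↔ v = c ∨ v = c') → ∃ z ∈ Z, G.Adj z d' := by
    intro d d' hd hd' hda hda' hdd' hbd₁ hbd₂ hpair
    have had' : d' ∉ Z := fun h => by
      have := hZnot d' (hZW h)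
      have := (hpair d').1 (Or.inr rfl)
      simp only [Set.mem_insert_iff, Set.mem_singleton_iff, not_or] at *
      tauto
    have hmem' : d' ∈ (A ∪ B : Set V) \ {d, b₁, b₂} := by
      refine ⟨Or.inl hd', ?_⟩
      simp only [Set.mem_insert_iff, Set.mem_singleton_iff, not_or]
      exact ⟨hdd'.symm, hneAB d' hd' b₁ hb₁, hneAB d' hd' b₂ hb₂⟩
    have hamem : a ∈ (A ∪ B : Set V) \ {d, b₁, b₂} := by
      refine ⟨Or.inl ha, ?_⟩
      simp only [Set.mem_insert_iff, Set.mem_singleton_iff, not_or]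
      exact ⟨hda.symm, hneAB a ha b₁ hb₁, hneAB a ha b₂ hb₂⟩
    have hcut := cutConnected_of_minimal (ih G) hbip hminor hcount hd hb₁ hb₂ h₁₂ hbd₁.symm
      hbd₂.symm hmem'
    obtain ⟨u, ⟨hu, huZ⟩, v, ⟨hv, hvZ⟩, huv⟩ := hcut.2 (insert a Z) ⟨a, hamem, Or.inl rfl⟩
      ⟨d', hmem', by
        rintro (h | h)
        · exact hda' h
        · exact had' h⟩
    simp only [Set.mem_sdiff, Set.mem_union, mem_coe, Set.mem_insert_iff, Set.mem_singleton_iff,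
      not_or] at hu hv hvZ
    rcases huZ with rfl | huZ
    · have hvB : v ∈ B := by
        rcases hv.1 with h | h
        · exact absurd huv (hbip.left u ha v h)
        · exact h
      rcases (hNmem v).1 ⟨hvB, huv⟩ with h | h | h
      · exact absurd h hv.2.2.1
      · exact absurd h hv.2.2.2
      · exact absurd (h ▸ hb₃Z) hvZ.2
    · by_cases hvd : v = d'
      · exact ⟨u, huZ, hvd ▸ huv⟩
      · refine absurd (hclosed u huZ v ⟨hv.1, ?_⟩ huv) hvZ.2
        have := hpair v
        simp only [Set.mem_insert_iff, Set.mem_singleton_iff, not_or]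
        tauto
  have hdis : ∀ v ∈ ([b₁, b₂, a, c, c'] : List V), v ∉ Z := fun v hv hvZ => by
    have := hZnot v (hZW hvZ)
    simp only [List.mem_cons, List.not_mem_nil, or_false, Set.mem_insert_iff,
      Set.mem_singleton_iff, not_or] at *
    tauto
  refine hminor (hasMinorOn_completeBipartiteGraph (Z := Z) (b₁ := b₁) (b₂ := b₂) (a := a)
    (c := c) (c' := c') ?_ (fun z hz => (hZW hz).1) hZ ?_ hdis ?_ ?_ ?_)
  · simp [ha, hb₁, hb₂, hcA, hcA']
  · simp [h₁₂, hca.symm, hca'.symm, hcc', (hneAB a ha b₁ hb₁).symm, (hneAB a ha b₂ hb₂).symm,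
      hbc₁.ne, hbc₂.ne, hbc₁'.ne, hbc₂'.ne]
  · simp [hab₁.symm, hbc₁, hbc₁']
  · simp [hab₂.symm, hbc₂, hbc₂']
  · simp only [List.mem_cons, List.not_mem_nil, or_false, forall_eq_or_imp, forall_eq]
    exact ⟨⟨b₃, hb₃Z, hab₃.symm⟩,
      htouch c' c hcA' hcA hca' hca hcc'.symm hbc₁' hbc₂' (fun v => or_comm),
      htouch c c' hcA hcA' hca hca' hcc' hbc₁ hbc₂ (fun v => Iff.rfl)⟩

lemma crossCount_le_mul (G : SimpleGraph V) (A B : Finset V) : crossCount G A B ≤ #A * #B := by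
  classical
  rw [← smul_eq_mul]
  exact sum_le_card_nsmul A _ _ fun a _ => card_filter_le _ _

open Classical in
/-- A minimal violation of the bipartite bound has minimum degree at least three. -/
lemma three_le_degree_of_minimal {G : SimpleGraph V} {A B : Finset V}
    (ih : ∀ A' B', #A' + #B' < #A + #B → SatisfiesBipartiteBound G A' B')
    (hbip : IsBipartition G A B) (hcard : 4 ≤ #A + #B)
    (hminor : ¬ HasMinorOn G (A ∪ B : Set V) (completeBipartiteGraph (Fin 3) (Fin 3)))
    (hcount : 2 * (#A + #B) < crossCount G A B + 4) {a : V} (ha : a ∈ A) :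
    3 ≤ #{b ∈ B | G.Adj a b} := by
  have hA := card_erase_of_mem ha
  have hA0 := card_pos.2 ⟨a, ha⟩
  have hdel := crossCount_erase_left G B ha
  have := ih (A.erase a) B (by omega) (hbip.mono (erase_subset _ _) subset_rfl) (by omega)
    (fun h => hminor (h.mono le_rfl (Set.union_subset_union_left _ (by
      exact_mod_cast erase_subset a A))))
  omega

theorem satisfiesBipartiteBound (G : SimpleGraph V) (A B : Finset V) :
    SatisfiesBipartiteBound G A B := by
  classical
  induction hn : #A + #B using Nat.strong_induction_on generalizing G A B with
  | _ n ih =>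
  induction hm : crossCount G A B using Nat.strong_induction_on generalizing G with
  | _ m ih' =>
  subst hn hm
  intro hbip hthree hminor
  by_contra! hcount
  replace ih : ∀ (G' : SimpleGraph V) A' B', #A' + #B' < #A + #B →
      SatisfiesBipartiteBound G' A' B' := fun G' A' B' h => ih _ h G' A' B' rfl
  have ihs : ∀ (G' : SimpleGraph V) A' B', #A' + #B' < #B + #A →
      SatisfiesBipartiteBound G' A' B' := fun G' A' B' h => ih G' A' B' (by omega)
  have hminors : ¬ HasMinorOn G (B ∪ A : Set V) (completeBipartiteGraph (Fin 3) (Fin 3)) := by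
    rwa [Set.union_comm]
  have hcounts : 2 * (#B + #A) < crossCount G B A + 4 := by
    rwa [crossCount_comm, add_comm]
  have hfour : 4 ≤ #A + #B := by
    by_contra! hlt
    have hmul := crossCount_le_mul G A B
    have hA : #A ≤ 3 := by omega
    have hB : #B = 3 - #A := by omega
    rw [hB] at hmul hcount
    interval_cases #A <;> omega
  have hdegA : ∀ a ∈ A, 3 ≤ #{b ∈ B | G.Adj a b} := fun a ha =>
    three_le_degree_of_minimal (ih G) hbip hfour hminor hcount ha
  have hdegB : ∀ b ∈ B, 3 ≤ #{a ∈ A | G.Adj b a} := fun b hb =>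
    three_le_degree_of_minimal (ihs G) hbip.symm (by omega) hminors hcounts hb
  obtain ⟨a, ha, b, hb, hab⟩ : ∃ a ∈ A, ∃ b ∈ B, G.Adj a b := by
    by_contra! hno
    have : crossCount G A B = 0 := sum_eq_zero fun a ha =>
      card_eq_zero.2 (filter_eq_empty_iff.2 fun b hb => hno a ha b hb)
    omega
  have hB3 : 3 ≤ #B := (hdegA a ha).trans (card_filter_le _ _)
  have hA3 : 3 ≤ #A := (hdegB b hb).trans (card_filter_le _ _)
  have hA4 : ∀ a ∈ A, 4 ≤ #{b ∈ B | G.Adj a b} := fun a ha =>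
    lt_of_le_of_ne (hdegA a ha) fun h =>
      hminor (hasMinorOn_of_degree_three ih hbip (by omega) hcount ha h.symm)
  have hB4 : ∀ b ∈ B, 4 ≤ #{a ∈ A | G.Adj b a} := fun b hb =>
    lt_of_le_of_ne (hdegB b hb) fun h =>
      hminors (hasMinorOn_of_degree_three ihs hbip.symm (by omega) hcounts hb h.symm)
  have hsumA : #A * 4 ≤ crossCount G A B := card_nsmul_le_sum A _ 4 hA4
  have hsumB : #B * 4 ≤ crossCount G A B := by
    rw [crossCount_comm]
    exact card_nsmul_le_sum B _ 4 hB4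
  let G' := G.deleteEdges {s(a, b)}
  have hle : G' ≤ G := deleteEdges_le _
  have h₁ := crossCount_lt_crossCount hle ha hb hab (by simp [G', deleteEdges_adj])
  have h₂ := crossCount_le_add_one (G := G) (G' := G') (a := a) (b := b)
    (disjoint_right.1 hbip.disjoint hb) (fun x y hxy => by
      simp only [G', deleteEdges_adj, hxy, true_and, Set.mem_singleton_iff, Sym2.eq_iff]
      tauto) B
  have := ih' _ h₁ G' rfl ⟨hbip.disjoint, fun u hu v hv h => hbip.left u hu v hv (hle h),
    fun u hu v hv h => hbip.right u hu v hv (hle h)⟩ hthree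
    (fun h => hminor (h.mono hle subset_rfl))
  omega

/-- The weak form of the bipartite bound, for arbitrary disjoint vertex sets. -/
theorem crossCount_le_two_mul {G : SimpleGraph V} {A B : Finset V} (hAB : Disjoint A B)
    (hG : ¬ HasMinor G (completeBipartiteGraph (Fin 3) (Fin 3))) :
    crossCount G A B ≤ 2 * (#A + #B) := by
  classical
  rcases Nat.lt_or_ge (#A + #B) 3 with h | h
  · have hmul := crossCount_le_mul G A B
    have hA : #A ≤ 2 := by omega
    have hB : #B ≤ 2 := by omega
    interval_cases #A <;> interval_cases #B <;> omega
  · let G' : SimpleGraph V := G ⊓ SimpleGraph.fromRel fun u v => u ∈ A ∧ v ∈ B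
    have hadj : ∀ u v, G'.Adj u v ↔
        G.Adj u v ∧ u ≠ v ∧ ((u ∈ A ∧ v ∈ B) ∨ (v ∈ A ∧ u ∈ B)) := by
      intro u v
      simp [G', SimpleGraph.fromRel_adj]
    have hcount : crossCount G A B = crossCount G' A B := crossCount_congr fun a ha b hb => by
      rw [hadj]
      exact ⟨fun h => ⟨h, h.ne, Or.inl ⟨ha, hb⟩⟩, fun h => h.1⟩
    have hd := disjoint_left.1 hAB
    have := satisfiesBipartiteBound G' A B ⟨hAB, fun u hu v hv h => ?_, fun u hu v hv h => ?_⟩ h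
      (fun hm => hG (hm.mono (S' := Set.univ) inf_le_left (Set.subset_univ _)).hasMinor)
    · omega
    · rcases ((hadj u v).1 h).2.2 with h | h
      · exact hd hv h.2
      · exact hd hu h.2
    · rcases ((hadj u v).1 h).2.2 with h | h
      · exact hd h.1 hu
      · exact hd h.1 hv

/-- Summing the bipartite bounds over thresholds: vertices `v` of threshold `T v ≥ t` are counted
against vertices of degree at least `t`, for `t = 7, …, 12`. -/
lemma sum_threshold_le [Fintype V] {G : SimpleGraph V} [DecidableRel G.Adj]
    (hG : ¬ HasMinor G (completeBipartiteGraph (Fin 3) (Fin 3))) (T : V → ℕ)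
    (hT : ∀ v, 6 < T v → G.degree v ≤ 6) :
    ∑ v, ∑ u ∈ G.neighborFinset v, #{t ∈ Icc 7 12 | t ≤ T v ∧ t ≤ G.degree u} ≤
      2 * ∑ v, (#{t ∈ Icc 7 12 | t ≤ T v} + #{t ∈ Icc 7 12 | t ≤ G.degree v}) := by
  classical
  have hbound : ∀ t ∈ Icc 7 12, crossCount G {v | t ≤ T v} {v | t ≤ G.degree v} ≤
      2 * (#{v | t ≤ T v} + #{v | t ≤ G.degree v}) := by
    intro t ht
    rw [mem_Icc] at ht
    refine crossCount_le_two_mul (disjoint_filter.2 fun v _ h h' => ?_) hG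
    have := hT v (by omega)
    omega
  calc _ = ∑ t ∈ Icc 7 12, crossCount G {v | t ≤ T v} {v | t ≤ G.degree v} := by
        simp only [card_filter]
        simp_rw [sum_comm (s := G.neighborFinset _)]
        rw [sum_comm]
        refine sum_congr rfl fun t _ => ?_
        rw [crossCount, sum_filter]
        refine sum_congr rfl fun v _ => ?_
        split_ifs with h
        · rw [← card_filter]
          congr 1
          ext u
          simp [h, and_comm]
        · simp [h]
    _ ≤ _ := sum_le_sum hbound
    _ = _ := by
        rw [← mul_sum, sum_add_distrib, sum_add_distrib]
        simp only [card_filter]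
        rw [sum_comm,
          sum_comm (s := Icc 7 12) (f := fun t v => if t ≤ G.degree v then 1 else 0)]

lemma card_thresholds (n : ℕ) : #{t ∈ Icc 7 12 | t ≤ n} = min n 12 - 6 := by
  have : {t ∈ Icc 7 12 | t ≤ n} = Icc 7 (min n 12) := by
    ext t
    simp only [mem_filter, mem_Icc]
    omega
  rw [this, Nat.card_Icc]
  omega

lemma card_thresholds_and (m n : ℕ) :
    #{t ∈ Icc 7 12 | t ≤ m ∧ t ≤ n} = min (min m n) 12 - 6 := by
  simp only [← le_min_iff]
  exact card_thresholds _

/-- The discharging inequality in sum form. -/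
lemma exists_lt_of_planar [Fintype V] [Nonempty V] {G : SimpleGraph V} [DecidableRel G.Adj]
    (hG : IsPlanar G) (T : V → ℕ) (hT : ∀ v, 6 < T v → G.degree v ≤ 6) :
    ∃ v, 2 * G.degree v + ∑ u ∈ G.neighborFinset v, (min (min (T v) (G.degree u)) 12 - 6) <
      12 + 2 * ((min (T v) 12 - 6) + (min (G.degree v) 12 - 6)) := by
  classical
  by_contra! hno
  have h₁ := sum_threshold_le hG.2 T hT
  simp only [card_thresholds, card_thresholds_and] at h₁
  have h₂ := crossCount_self_add_six_le (G := G) (S := univ) univ_nonempty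
    (fun h => hG.1 h.hasMinor)
  have h₃ : crossCount G univ univ = ∑ v, G.degree v := sum_congr rfl fun v _ => by
    rw [← card_neighborFinset_eq_degree, neighborFinset_eq_filter]
    congr
  have h₄ := sum_le_sum fun v (_ : v ∈ univ) => hno v
  simp only [sum_add_distrib, ← mul_sum, sum_const, smul_eq_mul] at h₁ h₄
  omega

open Classical in
/-- The highest degree class against which a vertex of degree at most five is balanced. -/
noncomputable def threshold [Fintype V] (G : SimpleGraph V) [DecidableRel G.Adj] (v : V) : ℕ :=
  if G.degree v = 3 then 12
  else if G.degree v = 4 then if ∀ u, G.Adj v u → 8 ≤ G.degree u then 8 else 10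
  else if G.degree v = 5 then
    if ∀ u, G.Adj v u → 7 ≤ G.degree u then 7
    else if ∃ w, ∀ u, G.Adj v u → u ≠ w → 8 ≤ G.degree u then 8 else 9
  else 6

lemma card_sub_mul_le_sum {s e : Finset V} {f : V → ℕ} {c : ℕ}
    (h : ∀ u ∈ s, u ∉ e → c ≤ f u) : (#s - #e) * c ≤ ∑ u ∈ s, f u := by
  classical
  calc (#s - #e) * c ≤ #(s \ e) * c := Nat.mul_le_mul_right _ (le_card_sdiff e s)
    _ ≤ ∑ u ∈ s \ e, f u := card_nsmul_le_sum _ _ _ fun u hu =>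
        h u (mem_sdiff.1 hu).1 (mem_sdiff.1 hu).2
    _ ≤ ∑ u ∈ s, f u := sum_le_sum_of_subset sdiff_subset

/-- In every connected planar graph there is a vertex `v` such that one of the
configurations (A1)–(A4) occurs (neighbors listed in increasing order of degree,
so e.g. in (A3) the two listed neighbors are distinct, of degrees ≤ 7 and ≤ 9). -/
theorem planar_structural_lemma
    {V : Type u} [Fintype V] (G : SimpleGraph V) [DecidableRel G.Adj]
    (hplanar : IsPlanar G) (hconn : G.Connected) :
    ∃ v : V,
      (G.degree v ≤ 2) ∨
      (G.degree v = 3 ∧ ∃ v₁, G.Adj v v₁ ∧ G.degree v₁ ≤ 11) ∨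
      (G.degree v = 4 ∧ ∃ v₁ v₂, G.Adj v v₁ ∧ G.Adj v v₂ ∧ v₁ ≠ v₂ ∧
        G.degree v₁ ≤ 7 ∧ G.degree v₂ ≤ 9) ∨
      (G.degree v = 5 ∧ ∃ v₁ v₂ v₃, G.Adj v v₁ ∧ G.Adj v v₂ ∧ G.Adj v v₃ ∧
        v₁ ≠ v₂ ∧ v₁ ≠ v₃ ∧ v₂ ≠ v₃ ∧
        G.degree v₁ ≤ 6 ∧ G.degree v₂ ≤ 7 ∧ G.degree v₃ ≤ 8) := by
  classical
  have := hconn.nonempty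
  by_contra! hno
  obtain ⟨v, hv⟩ := exists_lt_of_planar hplanar (threshold G) (fun v hv => by
    by_contra! h
    unfold threshold at hv
    rw [if_neg (by omega), if_neg (by omega), if_neg (by omega)] at hv
    omega)
  obtain ⟨hdeg, hthree, hfour, hfive⟩ := hno v
  have hcard := G.card_neighborFinset_eq_degree v
  have hsum : ∀ (e : Finset V) (c : ℕ), (∀ u, G.Adj v u → u ∉ e →
      c ≤ min (min (threshold G v) (G.degree u)) 12 - 6) → (G.degree v - #e) * c ≤
      ∑ u ∈ G.neighborFinset v, (min (min (threshold G v) (G.degree u)) 12 - 6) := by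
    intro e c h
    rw [← hcard]
    exact card_sub_mul_le_sum fun u hu => h u ((G.mem_neighborFinset v u).1 hu)
  by_cases h3 : G.degree v = 3
  · have hT : threshold G v = 12 := by rw [threshold, if_pos h3]
    have := hsum ∅ 6 fun u hu _ => by
      have := hthree h3 u hu
      omega
    rw [card_empty] at this
    omega
  by_cases h4 : G.degree v = 4
  · by_cases h8 : ∀ u, G.Adj v u → 8 ≤ G.degree u
    · have hT : threshold G v = 8 := by rw [threshold, if_neg h3, if_pos h4, if_pos h8]
      have := hsum ∅ 2 fun u hu _ => by
        have := h8 u hu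
        omega
      rw [card_empty] at this
      omega
    · have hT : threshold G v = 10 := by rw [threshold, if_neg h3, if_pos h4, if_neg h8]
      push Not at h8
      obtain ⟨w, hw, hw8⟩ := h8
      have := hsum {w} 4 fun u hu hne => by
        have := hfour h4 w u hw hu (fun h => hne (by simp [h])) (by omega)
        omega
      rw [card_singleton] at this
      omega
  by_cases h5 : G.degree v = 5
  · by_cases h7 : ∀ u, G.Adj v u → 7 ≤ G.degree u
    · have hT : threshold G v = 7 := by
        rw [threshold, if_neg h3, if_neg h4, if_pos h5, if_pos h7]
      have := hsum ∅ 1 fun u hu _ => by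
        have := h7 u hu
        omega
      rw [card_empty] at this
      omega
    by_cases h8 : ∃ w, ∀ u, G.Adj v u → u ≠ w → 8 ≤ G.degree u
    · have hT : threshold G v = 8 := by
        rw [threshold, if_neg h3, if_neg h4, if_pos h5, if_neg h7, if_pos h8]
      obtain ⟨w, hw⟩ := h8
      have := hsum {w} 2 fun u hu hne => by
        have := hw u hu (fun h => hne (by simp [h]))
        omega
      rw [card_singleton] at this
      omega
    · have hT : threshold G v = 9 := by
        rw [threshold, if_neg h3, if_neg h4, if_pos h5, if_neg h7, if_neg h8]
      push Not at h7 h8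
      obtain ⟨w, hw, hw7⟩ := h7
      obtain ⟨x, hx, hxw, hx8⟩ := h8 w
      have := hsum {w, x} 3 fun u hu hne => by
        simp only [mem_insert, mem_singleton, not_or] at hne
        have := hfive h5 w x u hw hx hu hxw.symm (Ne.symm hne.1) (Ne.symm hne.2) (by omega)
          (by omega)
        omega
      rw [card_pair hxw.symm] at this
      omega
  · have hT : threshold G v = 6 := by rw [threshold, if_neg h3, if_neg h4, if_neg h5]
    omega
end

section
/- Let uv be an edge of an acyclically edge k-critical graph G with k > Δ(G). If d(u) + d(v) ≤ k − Δ(G) + 4, then for every acyclic edge k-coloring φ of G − uv one has |C_φ(u) ∩ C_φ(v)| ≥ 2. -/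
open SimpleGraph Finset

universe u

variable {V : Type u}

section AcyclicEdgeColoring

/-- The spanning subgraph of `G` formed by the edges colored `a` or `b`. -/
def bicolored (G : SimpleGraph V) {k : ℕ} (φ : Sym2 V → Fin k) (a b : Fin k) : SimpleGraph V where
  Adj x y := G.Adj x y ∧ (φ s(x, y) = a ∨ φ s(x, y) = b)
  symm := ⟨fun x y h => ⟨h.1.symm, by rw [Sym2.eq_swap]; exact h.2⟩⟩
  loopless := ⟨fun x h => G.loopless.irrefl x h.1⟩

theorem bicolored_comm (G : SimpleGraph V) {k : ℕ} (φ : Sym2 V → Fin k) (a b : Fin k) :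
    bicolored G φ a b = bicolored G φ b a := by
  ext x y
  simp only [bicolored, or_comm]

theorem properEC_iff {G : SimpleGraph V} {k : ℕ} {φ : Sym2 V → Fin k} :
    ProperEC G φ ↔
      ∀ x y z, G.Adj x y → G.Adj x z → φ s(x, y) = φ s(x, z) → y = z := by
  constructor
  · intro h x y z hy hz he
    by_contra hne
    refine h s(x, y) hy s(x, z) hz ?_ ⟨x, by simp, by simp⟩ he
    intro h'
    exact hne (Sym2.congr_right.mp h')
  · rintro h e₁ h₁ e₂ h₂ hne ⟨x, hx₁, hx₂⟩ he
    obtain ⟨y, rfl⟩ := Sym2.mem_iff_exists.mp hx₁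
    obtain ⟨z, rfl⟩ := Sym2.mem_iff_exists.mp hx₂
    exact hne (by rw [h x y z h₁ h₂ he])

theorem acyclicEC_iff {G : SimpleGraph V} {k : ℕ} {φ : Sym2 V → Fin k} :
    AcyclicEC G φ ↔ ProperEC G φ ∧ ∀ a b, (bicolored G φ a b).IsAcyclic := by
  refine and_congr_right fun _ => ⟨fun h a b v w hw => ?_, fun h v w hw => ?_⟩
  · have hle : bicolored G φ a b ≤ G := fun x y hxy => hxy.1
    have h2 := h v (w.mapLe hle) (hw.mapLe hle)
    rw [Walk.edges_mapLe_eq_edges] at h2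
    have hsub : (w.edges.map φ).toFinset ⊆ {a, b} := by
      intro d hd
      simp only [List.mem_toFinset, List.mem_map] at hd
      obtain ⟨e, he, rfl⟩ := hd
      have hm := w.edges_subset_edgeSet he
      induction e with
      | _ x y => simpa using (show (bicolored G φ a b).Adj x y from hm).2
    have := (Finset.card_le_card hsub).trans Finset.card_le_two
    lia
  · by_contra hcard
    obtain ⟨a, b, hab⟩ : ∃ a b, (w.edges.map φ).toFinset ⊆ {a, b} := by
      set s := (w.edges.map φ).toFinset with hs
      have h012 : s.card = 0 ∨ s.card = 1 ∨ s.card = 2 := by lia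
      rcases h012 with h0 | h1 | h2
      · rw [Finset.card_eq_zero] at h0
        have hn : w.edges ≠ [] := by
          intro h'
          have := hw.three_le_length
          rw [← Walk.length_edges, h'] at this
          simp at this
        exact ⟨φ (w.edges.head hn), φ (w.edges.head hn), by simp [h0]⟩
      · obtain ⟨a, ha⟩ := Finset.card_eq_one.mp h1
        exact ⟨a, a, by simp [ha]⟩
      · obtain ⟨a, b, -, hb⟩ := Finset.card_eq_two.mp h2
        exact ⟨a, b, hb.le⟩
    have hq : ∀ e ∈ w.edges, e ∈ (bicolored G φ a b).edgeSet := by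
      intro e he
      have hm := w.edges_subset_edgeSet he
      have hc : φ e ∈ ({a, b} : Finset (Fin k)) :=
        hab (List.mem_toFinset.mpr (List.mem_map.mpr ⟨e, he, rfl⟩))
      induction e with
      | _ x y => exact ⟨hm, by simpa using hc⟩
    exact h a b _ (hw.transfer hq)

theorem AcyclicEC.anti {G H : SimpleGraph V} {k : ℕ} {φ : Sym2 V → Fin k} (h : AcyclicEC G φ)
    (hle : H ≤ G) : AcyclicEC H φ := by
  rw [acyclicEC_iff, properEC_iff] at *
  exact ⟨fun x y z hy hz => h.1 x y z (hle hy) (hle hz),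
    fun a b => (h.2 a b).anti (by rintro x y ⟨hxy, hc⟩; exact ⟨hle hxy, hc⟩)⟩

theorem AcyclicEC.eq_of_adj {G : SimpleGraph V} {k : ℕ} {φ : Sym2 V → Fin k} (h : AcyclicEC G φ)
    {x y z : V} (hy : G.Adj x y) (hz : G.Adj x z) (he : φ s(x, y) = φ s(x, z)) : y = z :=
  properEC_iff.mp h.1 x y z hy hz he

theorem mem_Cset {G : SimpleGraph V} {k : ℕ} {φ : Sym2 V → Fin k} {x y : V} (h : G.Adj x y) :
    φ s(x, y) ∈ Cset G φ x := ⟨y, h, rfl⟩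

theorem Cset_deleteEdges_left {G : SimpleGraph V} {k : ℕ} {φ : Sym2 V → Fin k}
    (hφ : AcyclicEC G φ) {x y : V} (h : G.Adj x y) :
    Cset (G.deleteEdges {s(x, y)}) φ x = Cset G φ x \ {φ s(x, y)} := by
  ext d
  constructor
  · rintro ⟨z, hz, rfl⟩
    simp only [deleteEdges_adj, Set.mem_singleton_iff] at hz
    refine ⟨mem_Cset hz.1, fun he => hz.2 ?_⟩
    rw [hφ.eq_of_adj hz.1 h he]
  · rintro ⟨⟨z, hz, rfl⟩, hne⟩
    refine ⟨z, ?_, rfl⟩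
    simp only [deleteEdges_adj, Set.mem_singleton_iff]
    refine ⟨hz, fun he => hne ?_⟩
    simp [he]

theorem Cset_deleteEdges_right {G : SimpleGraph V} {k : ℕ} {φ : Sym2 V → Fin k}
    (hφ : AcyclicEC G φ) {x y : V} (h : G.Adj x y) :
    Cset (G.deleteEdges {s(x, y)}) φ y = Cset G φ y \ {φ s(x, y)} := by
  rw [Sym2.eq_swap]
  exact Cset_deleteEdges_left hφ h.symm

theorem Cset_deleteEdges_of_ne {G : SimpleGraph V} {k : ℕ} {φ : Sym2 V → Fin k} {x y z : V}
    (hx : z ≠ x) (hy : z ≠ y) : Cset (G.deleteEdges {s(x, y)}) φ z = Cset G φ z := by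
  ext d
  simp only [Cset, deleteEdges_adj, Set.mem_singleton_iff, Set.mem_ofPred_eq, Sym2.eq_iff]
  grind

theorem Cset_update_left [DecidableEq V] {G : SimpleGraph V} {k : ℕ} {φ : Sym2 V → Fin k}
    {x y : V} (h : G.Adj x y) (a : Fin k) :
    Cset G (Function.update φ s(x, y) a) x =
      insert a (Cset (G.deleteEdges {s(x, y)}) φ x) := by
  ext d
  constructor
  · rintro ⟨z, hz, rfl⟩
    by_cases he : s(x, z) = s(x, y)
    · simp [he]
    · rw [Function.update_of_ne he]
      exact Or.inr ⟨z, by simp only [deleteEdges_adj]; exact ⟨hz, he⟩, rfl⟩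
  · rintro (rfl | ⟨z, hz, rfl⟩)
    · exact ⟨y, h, by simp⟩
    · simp only [deleteEdges_adj] at hz
      exact ⟨z, hz.1, Function.update_of_ne hz.2 _ _⟩

theorem Cset_update_of_ne [DecidableEq V] {G : SimpleGraph V} {k : ℕ} {φ : Sym2 V → Fin k}
    {x y z : V} (hx : z ≠ x) (hy : z ≠ y) (a : Fin k) :
    Cset G (Function.update φ s(x, y) a) z = Cset G φ z := by
  ext d
  have : ∀ t, s(z, t) ≠ s(x, y) := by
    intro t; simp only [ne_eq, Sym2.eq_iff]; grind
  simp [Cset, Function.update_of_ne (this _)]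

theorem exists_adj_of_reachable {G : SimpleGraph V} {x y : V} (h : G.Reachable x y)
    (hne : x ≠ y) : ∃ z, G.Adj x z := by
  obtain ⟨w⟩ := h
  cases w with
  | nil => exact absurd rfl hne
  | cons h _ => exact ⟨_, h⟩

theorem mem_inter_of_reachable {F : SimpleGraph V} {k : ℕ} {φ : Sym2 V → Fin k} {x y : V}
    (hne : x ≠ y) {a b : Fin k} (hx : a ∉ Cset F φ x) (hy : a ∉ Cset F φ y)
    (h : (bicolored F φ a b).Reachable x y) : b ∈ Cset F φ x ∩ Cset F φ y := by
  obtain ⟨z, hz, hz'⟩ := exists_adj_of_reachable h hne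
  obtain ⟨t, ht, ht'⟩ := exists_adj_of_reachable h.symm hne.symm
  exact ⟨⟨z, hz, hz'.resolve_left fun e => hx ⟨z, hz, e⟩⟩,
    ⟨t, ht, ht'.resolve_left fun e => hy ⟨t, ht, e⟩⟩⟩

theorem AcyclicEC.extend [DecidableEq V] {G : SimpleGraph V} {k : ℕ} {φ : Sym2 V → Fin k}
    {x y : V} (h : G.Adj x y) (hφ : AcyclicEC (G.deleteEdges {s(x, y)}) φ) {a : Fin k}
    (hx : a ∉ Cset (G.deleteEdges {s(x, y)}) φ x)
    (hy : a ∉ Cset (G.deleteEdges {s(x, y)}) φ y)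
    (hr : ∀ b, ¬ (bicolored (G.deleteEdges {s(x, y)}) φ a b).Reachable x y) :
    AcyclicEC G (Function.update φ s(x, y) a) := by
  set F := G.deleteEdges {s(x, y)} with hF
  have hadj : ∀ {p q}, G.Adj p q → s(p, q) ≠ s(x, y) → F.Adj p q := by
    intro p q hpq hne
    simp only [hF, deleteEdges_adj]
    exact ⟨hpq, hne⟩
  have hmiss : ∀ {p q r}, s(p, q) = s(x, y) → G.Adj p r → s(p, r) ≠ s(x, y) →
      φ s(p, r) ≠ a := by
    intro p q r hpq hpr hne he
    have hp : p = x ∨ p = y := by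
      have : p ∈ s(x, y) := hpq ▸ Sym2.mem_mk_left p q
      simpa using this
    rcases hp with rfl | rfl
    · exact hx ⟨r, hadj hpr hne, he⟩
    · exact hy ⟨r, hadj hpr hne, he⟩
  have hproper := properEC_iff.mp (acyclicEC_iff.mp hφ).1
  have hacyc := (acyclicEC_iff.mp hφ).2
  rw [acyclicEC_iff, properEC_iff]
  refine ⟨fun p q r hq hr' he => ?_, ?_⟩
  · by_cases h1 : s(p, q) = s(x, y) <;> by_cases h2 : s(p, r) = s(x, y)
    · exact Sym2.congr_right.mp (h1.trans h2.symm)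
    · rw [h1, Function.update_self, Function.update_of_ne h2] at he
      exact absurd he.symm (hmiss h1 hr' h2)
    · rw [h2, Function.update_self, Function.update_of_ne h1] at he
      exact absurd he (hmiss h2 hq h1)
    · rw [Function.update_of_ne h1, Function.update_of_ne h2] at he
      exact hproper p q r (hadj hq h1) (hadj hr' h2) he
  · have key : ∀ b, (bicolored G (Function.update φ s(x, y) a) a b).IsAcyclic := by
      intro b
      refine (IsAcyclic.sup_edge_of_not_reachable (hr b) (hacyc a b)).anti ?_
      rintro p q ⟨hpq, hc⟩
      by_cases he : s(p, q) = s(x, y)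
      · refine Or.inr ?_
        rw [edge_adj]
        exact ⟨by simpa using he, hpq.ne⟩
      · rw [Function.update_of_ne he] at hc
        exact Or.inl ⟨hadj hpq he, hc⟩
    intro b d
    by_cases hb : b = a
    · exact hb ▸ key d
    by_cases hd : d = a
    · rw [bicolored_comm]
      exact hd ▸ key b
    refine (hacyc b d).anti ?_
    rintro p q ⟨hpq, hc⟩
    by_cases he : s(p, q) = s(x, y)
    · rw [he, Function.update_self] at hc
      exact absurd hc (by grind)
    · rw [Function.update_of_ne he] at hc
      exact ⟨hadj hpq he, hc⟩

theorem AcyclicEC.extend_of_disjoint [DecidableEq V] {G : SimpleGraph V} {k : ℕ}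
    {φ : Sym2 V → Fin k} {x y : V} (h : G.Adj x y)
    (hφ : AcyclicEC (G.deleteEdges {s(x, y)}) φ) {a : Fin k}
    (hx : a ∉ Cset (G.deleteEdges {s(x, y)}) φ x)
    (hy : a ∉ Cset (G.deleteEdges {s(x, y)}) φ y)
    (hd : Disjoint (Cset (G.deleteEdges {s(x, y)}) φ x) (Cset (G.deleteEdges {s(x, y)}) φ y)) :
    AcyclicEC G (Function.update φ s(x, y) a) :=
  hφ.extend h hx hy fun b hb => by
    have := mem_inter_of_reachable h.ne hx hy hb
    exact Set.disjoint_left.mp hd this.1 this.2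

/-- In a graph of maximum degree at most two, a path cannot be continued to two distinct
vertices of degree at most one. -/
theorem false_of_paths {T : SimpleGraph V}
    (h2 : ∀ a b c d, T.Adj a b → T.Adj a c → T.Adj a d → b = c ∨ c = d ∨ b = d) {x y : V}
    (hx : ∀ b c, T.Adj x b → T.Adj x c → b = c) (hy : ∀ b c, T.Adj y b → T.Adj y c → b = c)
    (hxy : x ≠ y) {a : V} (p : T.Walk a x) (hp : p.IsPath) (q : T.Walk a y) (hq : q.IsPath)
    {r : V} (hr : T.Adj a r) (hrp : r ∉ p.support) (hrq : r ∉ q.support) : False := by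
  induction p generalizing r with
  | nil =>
    cases q with
    | nil => exact hxy rfl
    | cons h q => exact hrq (by simp [hx _ _ hr h])
  | cons h p ih =>
    cases q with
    | nil => exact hrp (by simp [hy _ _ hr h])
    | cons h' q =>
      rw [Walk.cons_isPath_iff] at hp hq
      rw [Walk.support_cons, List.mem_cons, not_or] at hrp hrq
      rcases h2 _ _ _ _ hr h h' with rfl | rfl | rfl
      · exact hrp.2 p.start_mem_support
      · exact ih hx hxy hp.1 q hq.1 h.symm hp.2 hq.2
      · exact hrq.2 q.start_mem_support

theorem false_of_three_ends {T : SimpleGraph V}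
    (h2 : ∀ a b c d, T.Adj a b → T.Adj a c → T.Adj a d → b = c ∨ c = d ∨ b = d) {u x y : V}
    (hu : ∀ b c, T.Adj u b → T.Adj u c → b = c)
    (hx : ∀ b c, T.Adj x b → T.Adj x c → b = c) (hy : ∀ b c, T.Adj y b → T.Adj y c → b = c)
    (hux : u ≠ x) (huy : u ≠ y) (hxy : x ≠ y) (hrx : T.Reachable u x) (hry : T.Reachable u y) :
    False := by
  obtain ⟨p, hp⟩ := hrx.exists_isPath
  obtain ⟨q, hq⟩ := hry.exists_isPath
  cases p with
  | nil => exact hux rfl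
  | cons h p =>
    cases q with
    | nil => exact huy rfl
    | cons h' q =>
      obtain rfl := hu _ _ h h'
      rw [Walk.cons_isPath_iff] at hp hq
      exact false_of_paths h2 hx hy hxy p hp.1 q hq.1 h.symm hp.2 hq.2

theorem exists_reachable_last_adj {K T : SimpleGraph V} {u v : V}
    (hT : ∀ a b, a ≠ v → b ≠ v → K.Adj a b → T.Adj a b) (hne : u ≠ v) (h : K.Reachable u v) :
    ∃ x, K.Adj v x ∧ T.Reachable u x := by
  obtain ⟨w⟩ := h
  induction w with
  | nil => exact absurd rfl hne
  | @cons a b c h p ih =>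
    by_cases hb : b = c
    · subst hb
      exact ⟨a, h.symm, Reachable.refl _⟩
    · obtain ⟨x, hx, hr⟩ := ih hT hb
      exact ⟨x, hx, (hT _ _ hne hb h).reachable.trans hr⟩

/-- If the `u`–`v` connection in colors `a`, `c` leaves `u` through the edge `u z` colored `c`, then
`a` appears at `z`. -/
theorem mem_Cset_of_reachable {H : SimpleGraph V} {k : ℕ} {φ : Sym2 V → Fin k}
    (hφ : AcyclicEC H φ) {u v z : V} (hne : u ≠ v) (huv : ¬ H.Adj u v) (hz : H.Adj u z)
    {a : Fin k} (ha : a ∉ Cset H φ u) (hr : (bicolored H φ a (φ s(u, z))).Reachable u v) :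
    a ∈ Cset H φ z := by
  by_contra hna
  have closed : ∀ p q, (bicolored H φ a (φ s(u, z))).Adj p q → p = u ∨ p = z → q = u ∨ q = z := by
    rintro p q ⟨hpq, hc⟩ (rfl | rfl)
    · have := hc.resolve_left fun e => ha ⟨q, hpq, e⟩
      exact Or.inr (hφ.eq_of_adj hpq hz this)
    · have := hc.resolve_left fun e => hna ⟨q, hpq, e⟩
      rw [Sym2.eq_swap (a := u)] at this
      exact Or.inl (hφ.eq_of_adj hpq hz.symm this)
  have hv : ∀ p q, (bicolored H φ a (φ s(u, z))).Walk p q → p = u ∨ p = z → q = u ∨ q = z := by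
    intro p q w
    induction w with
    | nil => exact id
    | cons h _ ih => exact fun hp => ih (closed _ _ h hp)
  obtain ⟨w⟩ := hr
  rcases hv _ _ w (Or.inl rfl) with h | h
  · exact hne h.symm
  · exact huv (h ▸ hz)

theorem Cset_eq_insert_of_reachable {H : SimpleGraph V} {k : ℕ} {φ : Sym2 V → Fin k}
    (hφ : AcyclicEC H φ) {u v z : V} (hne : u ≠ v) (huv : ¬ H.Adj u v) (hz : H.Adj u z)
    {c : Fin k} (hc : φ s(u, z) = c) {S : Set (Fin k)} (hS : Disjoint S (Cset H φ u))
    (hr : ∀ a ∈ S, (bicolored H φ a c).Reachable u v)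
    (hcard : (Cset H φ z).ncard ≤ S.ncard + 1) : Cset H φ z = insert c S := by
  subst hc
  symm
  have hcS : φ s(u, z) ∉ S := fun h => Set.disjoint_left.mp hS h (mem_Cset hz)
  refine Set.eq_of_subset_of_ncard_le ?_ ?_
  · refine Set.insert_subset ?_ fun a ha => ?_
    · rw [Sym2.eq_swap]; exact mem_Cset hz.symm
    · exact mem_Cset_of_reachable hφ hne huv hz (Set.disjoint_left.mp hS ha) (hr a ha)
  · rwa [Set.ncard_insert_of_notMem hcS]

theorem false_of_forced [DecidableEq V] {H : SimpleGraph V} {k : ℕ} {u v : V} (hne : u ≠ v)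
    (huv : ¬ H.Adj u v)
    (hforce : ∀ φ : Sym2 V → Fin k, AcyclicEC H φ → ∀ c, Cset H φ u ∩ Cset H φ v = {c} →
      ∀ a ∈ (Cset H φ u ∪ Cset H φ v)ᶜ, (bicolored H φ a c).Reachable u v)
    {φ : Sym2 V → Fin k} (hφ : AcyclicEC H φ)
    (hcard : ∀ ψ : Sym2 V → Fin k, AcyclicEC H ψ → ∀ z,
      (Cset H ψ z).ncard ≤ ((Cset H φ u ∪ Cset H φ v)ᶜ).ncard + 1)
    {c : Fin k} (hc : Cset H φ u ∩ Cset H φ v = {c}) {a : Fin k}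
    (ha : a ∈ (Cset H φ u ∪ Cset H φ v)ᶜ) {b : Fin k} (hbv : b ∈ Cset H φ v)
    (hbu : b ∉ Cset H φ u) : False := by
  obtain ⟨⟨u', hu', hcu⟩, ⟨v', hv', hcv⟩⟩ : c ∈ Cset H φ u ∩ Cset H φ v := by simp [hc]
  obtain ⟨w, hw, hwb⟩ := hbv
  have hcu_mem : c ∈ Cset H φ u := ⟨u', hu', hcu⟩
  have hcv_mem : c ∈ Cset H φ v := ⟨v', hv', hcv⟩
  have hbv : b ∈ Cset H φ v := ⟨w, hw, hwb⟩
  have hbc : b ≠ c := fun h => hbu (h ▸ hcu_mem)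
  have huv' : ¬ H.Adj v u := fun h => huv h.symm
  have hinter : ∀ d, d ∈ Cset H φ u → d ∈ Cset H φ v → d = c := fun d h1 h2 => by
    have : d ∈ ({c} : Set (Fin k)) := hc ▸ ⟨h1, h2⟩
    exact this
  generalize hSdef : (Cset H φ u ∪ Cset H φ v)ᶜ = S at ha hcard
  have hS : ∀ d, d ∈ S ↔ d ∉ Cset H φ u ∧ d ∉ Cset H φ v := by
    intro d; rw [← hSdef]; simp
  have hSu : Disjoint S (Cset H φ u) := Set.disjoint_left.mpr fun d hd => ((hS d).mp hd).1
  have hSv : Disjoint S (Cset H φ v) := Set.disjoint_left.mpr fun d hd => ((hS d).mp hd).2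
  have hforce₀ : ∀ d ∈ S, (bicolored H φ d c).Reachable u v := fun d hd =>
    hforce φ hφ c hc d (hSdef ▸ hd)
  have hCu' : Cset H φ u' = insert c S :=
    Cset_eq_insert_of_reachable hφ hne huv hu' hcu hSu hforce₀ (hcard φ hφ u')
  have hCv' : Cset H φ v' = insert c S :=
    Cset_eq_insert_of_reachable hφ hne.symm huv' hv' hcv hSv
      (fun d hd => (hforce₀ d hd).symm) (hcard φ hφ v')
  have hu'_ne : v ≠ u' := by rintro rfl; exact huv hu'
  have huw : u ≠ w := by rintro rfl; exact huv' hw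
  have huv'_ne : u ≠ v' := by rintro rfl; exact huv' hv'
  have hv'_ne : v' ≠ w := by rintro rfl; exact hbc (hwb ▸ hcv)
  have hbS : b ∉ S := fun h => ((hS b).mp h).2 hbv
  have hcS : c ∉ S := fun h => ((hS c).mp h).2 hcv_mem
  have hwu' : w ≠ u' := by
    rintro rfl
    have : b ∈ Cset H φ w := ⟨v, hw.symm, by rw [Sym2.eq_swap]; exact hwb⟩
    rw [hCu'] at this
    exact this.elim hbc hbS
  -- the neighbor of `v` along `b` sees exactly `b` and the free colors
  have hCw : Cset H φ w = insert b S := by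
    have hdu := Cset_deleteEdges_left hφ hu'
    have hdu' := Cset_deleteEdges_right hφ hu'
    rw [hcu] at hdu hdu'
    rw [hCu'] at hdu'
    have h₁ : AcyclicEC H (Function.update φ s(u, u') b) := by
      refine (hφ.anti (deleteEdges_le _)).extend_of_disjoint hu' ?_ ?_ ?_
      · rw [hdu]; exact fun h => hbu h.1
      · rw [hdu']; exact fun h => h.1.elim hbc hbS
      · rw [hdu, hdu', Set.disjoint_left]
        rintro d ⟨h1, h2⟩ ⟨h3, -⟩
        exact h3.elim h2 fun h => ((hS d).mp h).1 h1
    have hv₁ : Cset H (Function.update φ s(u, u') b) v = Cset H φ v :=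
      Cset_update_of_ne hne.symm hu'_ne b
    have hu₁ : Cset H (Function.update φ s(u, u') b) u = insert b (Cset H φ u \ {c}) := by
      rw [Cset_update_left hu', hdu]
    have hS₁ : (Cset H (Function.update φ s(u, u') b) u ∪
        Cset H (Function.update φ s(u, u') b) v)ᶜ = S := by
      ext d
      rw [hS, hv₁, hu₁]
      simp only [Set.mem_compl_iff, Set.mem_union, Set.mem_insert_iff, Set.mem_sdiff,
        Set.mem_singleton_iff]
      grind
    have hc₁ : Cset H (Function.update φ s(u, u') b) u ∩
        Cset H (Function.update φ s(u, u') b) v = {b} := by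
      ext d
      rw [hv₁, hu₁]
      simp only [Set.mem_inter_iff, Set.mem_insert_iff, Set.mem_sdiff, Set.mem_singleton_iff]
      grind
    have hwne : s(v, w) ≠ s(u, u') := by simp only [ne_eq, Sym2.eq_iff]; grind
    have := Cset_eq_insert_of_reachable h₁ hne.symm huv' hw (c := b)
      (by rw [Function.update_of_ne hwne, hwb]) (hv₁ ▸ hSv)
      (fun d hd => (hforce _ h₁ b hc₁ d (hS₁ ▸ hd)).symm) (hcard _ h₁ w)
    rwa [Cset_update_of_ne huw.symm hwu'] at this
  -- exchange the colors of `v v'` and `v w`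
  set F := H.deleteEdges {s(v, w)} with hF
  have hφF : AcyclicEC F φ := hφ.anti (deleteEdges_le _)
  have hvv'_ne : s(v, v') ≠ s(v, w) := fun h => hv'_ne (Sym2.congr_right.mp h)
  have hFv' : F.Adj v v' := by
    simp only [hF, deleteEdges_adj]
    exact ⟨hv', hvv'_ne⟩
  have hFCv : Cset F φ v = Cset H φ v \ {b} := by rw [Cset_deleteEdges_left hφ hw, hwb]
  have hFCw : Cset F φ w = insert b S \ {b} := by rw [Cset_deleteEdges_right hφ hw, hwb, hCw]
  have hFCv' : Cset F φ v' = insert c S := by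
    rw [Cset_deleteEdges_of_ne hv'.ne.symm hv'_ne, hCv']
  have hFdv := Cset_deleteEdges_left hφF hFv'
  have hFdv' := Cset_deleteEdges_right hφF hFv'
  rw [hcv, hFCv] at hFdv
  rw [hcv, hFCv'] at hFdv'
  have hψ₁ : AcyclicEC F (Function.update φ s(v, v') b) := by
    refine (hφF.anti (deleteEdges_le _)).extend_of_disjoint hFv' ?_ ?_ ?_
    · rw [hFdv]; exact fun h => h.1.2 rfl
    · rw [hFdv']; exact fun h => h.1.elim hbc hbS
    · rw [hFdv, hFdv', Set.disjoint_left]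
      rintro d ⟨⟨h1, -⟩, h2⟩ ⟨h3, -⟩
      exact h3.elim h2 fun h => ((hS d).mp h).2 h1
  have hFv₁ : Cset F (Function.update φ s(v, v') b) v = insert b ((Cset H φ v \ {b}) \ {c}) := by
    rw [Cset_update_left hFv', hFdv]
  have hFw₁ : Cset F (Function.update φ s(v, v') b) w = insert b S \ {b} := by
    rw [Cset_update_of_ne hw.ne.symm hv'_ne.symm, hFCw]
  set ψ := Function.update (Function.update φ s(v, v') b) s(v, w) c with hψdef
  have hψ : AcyclicEC H ψ := by
    refine hψ₁.extend_of_disjoint hw ?_ ?_ ?_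
    · rw [hFv₁]; exact fun h => h.elim (fun h => hbc h.symm) fun h => h.2 rfl
    · rw [hFw₁]; exact fun h => h.1.elim (fun h => hbc h.symm) hcS
    · rw [hFv₁, hFw₁, Set.disjoint_left]
      rintro d h1 ⟨h3, h4⟩
      exact h1.elim h4 fun h => h3.elim h4 fun h' => ((hS d).mp h').2 h.1.1
  have hψv : Cset H ψ v = Cset H φ v := by
    rw [hψdef, Cset_update_left hw, hFv₁]
    ext d
    simp only [Set.mem_insert_iff, Set.mem_sdiff, Set.mem_singleton_iff]
    grind
  have hψu : Cset H ψ u = Cset H φ u := by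
    rw [hψdef, Cset_update_of_ne hne huw, Cset_update_of_ne hne huv'_ne]
  have hψvw : ψ s(v, w) = c := by simp [hψdef]
  have hψne : ∀ p q, p ≠ v → q ≠ v → ψ s(p, q) = φ s(p, q) := by
    intro p q hp hq
    rw [hψdef, Function.update_of_ne, Function.update_of_ne] <;>
    · simp only [ne_eq, Sym2.eq_iff]; grind
  have hrφ := hforce₀ a ha
  have hrψ := hforce ψ hψ c (by rw [hψu, hψv, hc]) a (by rw [hψu, hψv, hSdef]; exact ha)
  have hau := ((hS a).mp ha).1
  have hav := ((hS a).mp ha).2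
  let T : SimpleGraph V :=
    { Adj := fun p q => p ≠ v ∧ q ≠ v ∧ (bicolored H φ a c).Adj p q
      symm := ⟨fun p q h => ⟨h.2.1, h.1, h.2.2.symm⟩⟩
      loopless := ⟨fun p h => h.2.2.ne rfl⟩ }
  have hTv' : T.Reachable u v' := by
    obtain ⟨x, ⟨hx, hxc⟩, hr⟩ :=
      exists_reachable_last_adj (T := T) (fun p q hp hq h => ⟨hp, hq, h⟩) hne hrφ
    have := hxc.resolve_left fun e => hav ⟨x, hx, e⟩
    rwa [hφ.eq_of_adj hx hv' (this.trans hcv.symm)] at hr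
  have hTw : T.Reachable u w := by
    obtain ⟨x, ⟨hx, hxc⟩, hr⟩ := exists_reachable_last_adj (T := T)
      (by rintro p q hp hq ⟨h, hc⟩; exact ⟨hp, hq, h, by rwa [← hψne p q hp hq]⟩) hne hrψ
    have := hxc.resolve_left fun e => hav (hψv ▸ ⟨x, hx, e⟩)
    rwa [hψ.eq_of_adj hx hw (this.trans hψvw.symm)] at hr
  have hend : ∀ d x, (∀ q, T.Adj x q → φ s(x, q) = d) → ∀ q r, T.Adj x q → T.Adj x r → q = r :=
    fun d x h q r hq hr => hφ.eq_of_adj hq.2.2.1 hr.2.2.1 ((h q hq).trans (h r hr).symm)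
  refine false_of_three_ends (T := T) ?_ (hend c u ?_) (hend a v' ?_) (hend a w ?_)
    huv'_ne huw hv'_ne hTv' hTw
  · rintro p q r s ⟨-, -, hq, hqc⟩ ⟨-, -, hr, hrc⟩ ⟨-, -, hs, hsc⟩
    have h1 := hφ.eq_of_adj hq hr
    have h2 := hφ.eq_of_adj hr hs
    have h3 := hφ.eq_of_adj hq hs
    grind
  · rintro q ⟨-, -, hq, hqc⟩
    exact hqc.resolve_left fun e => hau ⟨q, hq, e⟩
  · rintro q ⟨-, hqv, hq, hqc⟩
    refine hqc.resolve_right fun e => hqv ?_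
    exact hφ.eq_of_adj hq hv'.symm (by rw [e, Sym2.eq_swap, hcv])
  · rintro q ⟨-, -, hq, hqc⟩
    refine hqc.resolve_right fun e => ?_
    have : c ∈ Cset H φ w := ⟨q, hq, e⟩
    rw [hCw] at this
    exact this.elim (fun h => hbc h.symm) hcS

theorem ncard_Cset [Fintype V] {H : SimpleGraph V} [DecidableRel H.Adj] {k : ℕ}
    {φ : Sym2 V → Fin k} (hφ : AcyclicEC H φ) (x : V) : (Cset H φ x).ncard = H.degree x := by
  have : Cset H φ x = (fun y => φ s(x, y)) '' H.neighborSet x := rfl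
  rw [this, Set.InjOn.ncard_image, Set.ncard_eq_toFinset_card' (H.neighborSet x)]
  · rfl
  exact fun y hy z hz he => hφ.eq_of_adj hy hz he

theorem degree_deleteEdges_add_one [Fintype V] [DecidableEq V] {G : SimpleGraph V}
    [DecidableRel G.Adj] {x y : V} (h : G.Adj x y) :
    (G.deleteEdges {s(x, y)}).degree x + 1 = G.degree x := by
  rw [← card_neighborFinset_eq_degree, ← card_neighborFinset_eq_degree]
  have : (G.deleteEdges {s(x, y)}).neighborFinset x = (G.neighborFinset x).erase y := by
    ext z
    simp only [mem_neighborFinset, deleteEdges_adj, Set.mem_singleton_iff, Finset.mem_erase,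
      Sym2.congr_right]
    tauto
  rw [this]
  exact Finset.card_erase_add_one (by simpa using h)

end AcyclicEdgeColoring

/-- Let `uv` be an edge of an acyclically edge `k`-critical graph with `k > Δ(G)`.
If `d(u) + d(v) ≤ k - Δ(G) + 4`, then every acyclic edge `k`-coloring `φ` of
`G - uv` satisfies `|C_φ(u) ∩ C_φ(v)| ≥ 2`. -/
theorem critical_common_colors_ge_two
    {V : Type u} [Fintype V] [DecidableEq V] (G : SimpleGraph V)
    [DecidableRel G.Adj] (k : ℕ)
    (hG : AcyclicallyEdgeCritical G k) (hk : G.maxDegree < k)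
    {u v : V} (huv : G.Adj u v)
    (hdeg : G.degree u + G.degree v ≤ k - G.maxDegree + 4)
    (φ : Sym2 V → Fin k) (hφ : AcyclicEC (G.deleteEdges {s(u, v)}) φ) :
    2 ≤ (Cset (G.deleteEdges {s(u, v)}) φ u ∩ Cset (G.deleteEdges {s(u, v)}) φ v).ncard := by
  classical
  by_contra hlt
  have hnadj : ¬ (G.deleteEdges {s(u, v)}).Adj u v := by simp
  have hne : u ≠ v := huv.ne
  have hdu : (G.deleteEdges {s(u, v)}).degree u + 1 = G.degree u := degree_deleteEdges_add_one huv
  have hdv : (G.deleteEdges {s(u, v)}).degree v + 1 = G.degree v := by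
    have := degree_deleteEdges_add_one huv.symm
    rw [← this]
    congr! 3
    rw [Sym2.eq_swap]
  have hforce : ∀ φ : Sym2 V → Fin k, AcyclicEC (G.deleteEdges {s(u, v)}) φ → ∀ c,
      Cset (G.deleteEdges {s(u, v)}) φ u ∩ Cset (G.deleteEdges {s(u, v)}) φ v ⊆ {c} →
      ∀ a ∈ (Cset (G.deleteEdges {s(u, v)}) φ u ∪ Cset (G.deleteEdges {s(u, v)}) φ v)ᶜ,
        (bicolored (G.deleteEdges {s(u, v)}) φ a c).Reachable u v := by
    intro φ hφ c hc a ha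
    simp only [Set.compl_union, Set.mem_inter_iff, Set.mem_compl_iff] at ha
    by_contra hr
    refine hG.1 ⟨_, hφ.extend huv ha.1 ha.2 fun b hb => ?_⟩
    obtain rfl : b = c := hc (mem_inter_of_reachable hne ha.1 ha.2 hb)
    exact hr hb
  have hcard : ∀ ψ : Sym2 V → Fin k, AcyclicEC (G.deleteEdges {s(u, v)}) ψ → ∀ z,
      (Cset (G.deleteEdges {s(u, v)}) ψ z).ncard ≤ G.maxDegree := by
    intro ψ hψ z
    rw [ncard_Cset hψ]
    exact (degree_le_of_le (deleteEdges_le _)).trans (G.degree_le_maxDegree z)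
  rw [← ncard_Cset hφ] at hdu hdv
  have hGu := G.degree_le_maxDegree u
  have hGv := G.degree_le_maxDegree v
  have hunion := Set.ncard_union_add_ncard_inter
    (Cset (G.deleteEdges {s(u, v)}) φ u) (Cset (G.deleteEdges {s(u, v)}) φ v)
  have hcompl := Set.ncard_add_ncard_compl
    (Cset (G.deleteEdges {s(u, v)}) φ u ∪ Cset (G.deleteEdges {s(u, v)}) φ v)
  rw [Nat.card_eq_fintype_card, Fintype.card_fin] at hcompl
  generalize G.deleteEdges {s(u, v)} = H at *
  obtain ⟨a, ha⟩ : ((Cset H φ u ∪ Cset H φ v)ᶜ).Nonempty := by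
    rw [← Set.ncard_pos]
    by_contra h0
    have : (Cset H φ u ∩ Cset H φ v).ncard ≤ (Cset H φ u).ncard :=
      Set.ncard_le_ncard Set.inter_subset_left
    lia
  have hn : (Cset H φ u ∩ Cset H φ v).ncard ≠ 0 := by
    intro h0
    rw [Set.ncard_eq_zero] at h0
    have ha' := ha
    simp only [Set.compl_union, Set.mem_inter_iff, Set.mem_compl_iff] at ha'
    have := mem_inter_of_reachable hne ha'.1 ha'.2 (hforce φ hφ a (by simp [h0]) a ha)
    simp [h0] at this
  obtain ⟨c, hc⟩ := Set.ncard_eq_one.mp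
    (show (Cset H φ u ∩ Cset H φ v).ncard = 1 by lia)
  have hn1 : (Cset H φ u ∩ Cset H φ v).ncard = 1 := by rw [hc, Set.ncard_singleton]
  have hS : G.maxDegree ≤ ((Cset H φ u ∪ Cset H φ v)ᶜ).ncard + 1 := by lia
  by_cases hvu : Cset H φ v ⊆ Cset H φ u
  · by_cases huv' : Cset H φ u ⊆ Cset H φ v
    · obtain ⟨z, hz, hzc⟩ : c ∈ Cset H φ u :=
        (show c ∈ Cset H φ u ∩ Cset H φ v by simp [hc]).1
      have hu : Cset H φ u = {c} := by rwa [Set.inter_eq_left.mpr huv'] at hc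
      have huniv : Cset H φ z = Set.univ := by
        refine Set.eq_univ_of_forall fun d => ?_
        by_cases hd : d ∈ Cset H φ u
        · obtain rfl : d = c := by simpa [hu] using hd
          exact ⟨u, hz.symm, by rw [Sym2.eq_swap]; exact hzc⟩
        · refine mem_Cset_of_reachable hφ hne hnadj hz hd ?_
          rw [hzc]
          exact hforce φ hφ c hc.le d (by rwa [Set.union_eq_left.mpr hvu])
      have := hcard φ hφ z
      rw [huniv, Set.ncard_univ, Nat.card_eq_fintype_card, Fintype.card_fin] at this
      lia
    · obtain ⟨b, hbu, hbv⟩ := Set.not_subset.mp huv'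
      refine false_of_forced (u := v) (v := u) hne.symm (fun h => hnadj h.symm) ?_ hφ
        (fun ψ hψ z => ?_) (c := c) (by rw [Set.inter_comm, hc]) (a := a)
        (by rwa [Set.union_comm]) hbu hbv
      · intro ψ hψ d hd e he
        exact (hforce ψ hψ d (by rw [Set.inter_comm, hd]) e (by rwa [Set.union_comm])).symm
      · rw [Set.union_comm]
        exact (hcard ψ hψ z).trans hS
  · obtain ⟨b, hbv, hbu⟩ := Set.not_subset.mp hvu
    exact false_of_forced hne hnadj (fun ψ hψ d hd => hforce ψ hψ d hd.le) hφ
      (fun ψ hψ z => (hcard ψ hψ z).trans hS) hc ha hbv hbu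
end
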